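/- arXiv:1806.10791 — 2 statements merged into one kernel-verified Lean document; each statement's English description precedes it below -/
import Mathlib

section
/- For every w ∈ W̃ and every s̃ ∈ S̃, the following two equivalences hold: ℓ̃(s̃ w) = ℓ̃(w) + 1 if and only if ℓ(s̃ w) = ℓ(w) + ℓ(s̃); and ℓ̃(s̃ w) = ℓ̃(w) − 1 if and only if ℓ(s̃ w) = ℓ(w) − ℓ(s̃). -/
/-!
Relative Coxeter groups: common definitions.

`(W, S)` is a Coxeter system (Mathlib's `CoxeterSystem M W`), `ℓ = cs.length`.
For `w : W`, `invSet cs w` is the set `T(w)` of left inversions of `w`, and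
`descSet cs w = T(w) ∩ S` is `D(w)`.  For a subset `Sg ⊆ S` (playing the role of `Σ`),
`par Sg` is the standard parabolic subgroup `W_Σ`, `parRefl Sg` its set of
reflections `T_Σ`, `minRight cs Sg = W^Σ`, `minLeft cs Sg = ^ΣW`,
`relN cs Sg Sg' = N(Σ, Σ')`, `IsLongest cs Sg w` says `w` is a longest element of `W_Σ`,
`longest cs Sg` is the longest element `w₀^Σ`, `relW cs Sg = W̃`,
`complSet cs Sg = Σ^∁`, `tilde cs Sg s = s̃ = w₀^{Σ∪{s}} w₀^Σ`, `relS cs Sg = S̃`,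
`relLength cs Sg = ℓ̃ : W → ℕ∞`, and `GoodSubset cs Sg` records the standing
hypotheses (1) and (2) on `Σ`.
-/

namespace RelativeCoxeter

variable {B W : Type*} [Group W] {M : CoxeterMatrix B}

/-- The set `S` of simple reflections of the Coxeter system. -/
def simpleSet (cs : CoxeterSystem M W) : Set W := Set.range cs.simple

/-- `T(w)`: the set of left inversions of `w`, i.e. reflections `t` with `ℓ(tw) < ℓ(w)`. -/
def invSet (cs : CoxeterSystem M W) (w : W) : Set W :=
  {t | cs.IsReflection t ∧ cs.length (t * w) < cs.length w}

/-- `D(w) = T(w) ∩ S`. -/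
def descSet (cs : CoxeterSystem M W) (w : W) : Set W :=
  invSet cs w ∩ simpleSet cs

/-- The standard parabolic subgroup `W_Σ` generated by `Σ`. -/
def par (Sg : Set W) : Subgroup W := Subgroup.closure Sg

/-- `T_Σ`: the set of reflections of the Coxeter system `(W_Σ, Σ)`. -/
def parRefl (Sg : Set W) : Set W :=
  {t | ∃ u ∈ par Sg, ∃ s ∈ Sg, t = u * s * u⁻¹}

/-- `W^Σ = {w : T(w⁻¹) ∩ T_Σ = ∅}`, minimal-length representatives of `W/W_Σ`. -/
def minRight (cs : CoxeterSystem M W) (Sg : Set W) : Set W :=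
  {w | invSet cs w⁻¹ ∩ parRefl Sg = ∅}

/-- `^ΣW = {w : T(w) ∩ T_Σ = ∅}`, minimal-length representatives of `W_Σ\W`. -/
def minLeft (cs : CoxeterSystem M W) (Sg : Set W) : Set W :=
  {w | invSet cs w ∩ parRefl Sg = ∅}

/-- `N(Σ, Σ') = {y ∈ W^Σ ∩ ^{Σ'}W : y W_Σ y⁻¹ = W_{Σ'}}`. -/
def relN (cs : CoxeterSystem M W) (Sg Sg' : Set W) : Set W :=
  {y | y ∈ minRight cs Sg ∧ y ∈ minLeft cs Sg' ∧
    (fun u => y * u * y⁻¹) '' (par Sg : Set W) = (par Sg' : Set W)}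

/-- `w` is a longest element of `W_Σ`. -/
def IsLongest (cs : CoxeterSystem M W) (Sg : Set W) (w : W) : Prop :=
  w ∈ par Sg ∧ ∀ u ∈ par Sg, cs.length u ≤ cs.length w

/-- The longest element `w₀^Σ` of `W_Σ` (defined when it exists; junk value `1` otherwise). -/
noncomputable def longest (cs : CoxeterSystem M W) (Sg : Set W) : W :=
  letI := Classical.propDecidable (∃ w, IsLongest cs Sg w)
  if h : ∃ w, IsLongest cs Sg w then h.choose else 1

/-- `W̃ = {w : w W_Σ w⁻¹ = W_Σ and T(w) ∩ T_Σ = ∅}`. -/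
def relW (cs : CoxeterSystem M W) (Sg : Set W) : Set W :=
  {w | (fun u => w * u * w⁻¹) '' (par Sg : Set W) = (par Sg : Set W) ∧
    invSet cs w ∩ parRefl Sg = ∅}

/-- `Σ^∁ = {s ∈ S ∖ Σ : W_{Σ∪{s}} is finite}`. -/
def complSet (cs : CoxeterSystem M W) (Sg : Set W) : Set W :=
  {s ∈ simpleSet cs \ Sg | ((par (Sg ∪ {s}) : Set W)).Finite}

/-- `s̃ = w₀^{Σ∪{s}} w₀^Σ`. -/
noncomputable def tilde (cs : CoxeterSystem M W) (Sg : Set W) (s : W) : W :=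
  longest cs (Sg ∪ {s}) * longest cs Sg

/-- `S̃ = {s̃ : s ∈ Σ^∁}`. -/
noncomputable def relS (cs : CoxeterSystem M W) (Sg : Set W) : Set W :=
  {w | ∃ s ∈ complSet cs Sg, w = tilde cs Sg s}

/-- `ℓ̃(w) ∈ ℕ ∪ {∞}`: the minimal `q` such that `w = w₁ ⋯ w_q` with all `w_i ∈ S̃`. -/
noncomputable def relLength (cs : CoxeterSystem M W) (Sg : Set W) (w : W) : ℕ∞ :=
  sInf {q : ℕ∞ | ∃ l : List W, (∀ x ∈ l, x ∈ relS cs Sg) ∧ l.prod = w ∧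
    (l.length : ℕ∞) = q}

/-- The standing hypotheses on `Σ`: `Σ ⊆ S`, `W_Σ` is finite, and for every `Σ'` with
`Σ ⊆ Σ' ⊆ S` and `W_{Σ'}` finite, the longest element `w₀^{Σ'}` normalises `W_Σ`. -/
def GoodSubset (cs : CoxeterSystem M W) (Sg : Set W) : Prop :=
  Sg ⊆ simpleSet cs ∧ ((par Sg : Set W)).Finite ∧
  ∀ Sg' : Set W, Sg ⊆ Sg' → Sg' ⊆ simpleSet cs → ((par Sg' : Set W)).Finite →
    ∀ w0 : W, IsLongest cs Sg' w0 →
      (fun u => w0 * u * w0⁻¹) '' (par Sg : Set W) = (par Sg : Set W)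

variable (cs : CoxeterSystem M W)

open Classical in
/-- The involution of `W × ZMod 2` attached to a simple reflection `s`: it conjugates the first
coordinate by `s` and flips the second one at `s`. -/
noncomputable def signedConj (i : B) : Function.End (W × ZMod 2) :=
  fun p => (cs.simple i * p.1 * cs.simple i, p.2 + if p.1 = cs.simple i then 1 else 0)

theorem simple_mul_pow (i j : B) (k : ℕ) :
    cs.simple j * (cs.simple i * cs.simple j) ^ k =
      ((cs.simple i * cs.simple j) ^ k)⁻¹ * cs.simple j := by
  induction k with
  | zero => simp
  | succ k ih =>
    rw [pow_succ, ← mul_assoc, ih, ← pow_succ, pow_succ']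
    simp [mul_assoc]

open Classical in
theorem signedConj_mul_pow_apply (i j : B) (k : ℕ) (t : W) (e : ZMod 2) :
    ((signedConj cs i * signedConj cs j) ^ k) (t, e) =
      ((cs.simple i * cs.simple j) ^ k * t * ((cs.simple i * cs.simple j) ^ k)⁻¹,
        e + ∑ n ∈ Finset.range (2 * k),
          if t = ((cs.simple i * cs.simple j) ^ n)⁻¹ * cs.simple j then 1 else 0) := by
  induction k with
  | zero => simp [Function.End.one_def]
  | succ k ih =>
    have hc : ∀ u : W, (cs.simple i * cs.simple j) ^ k * t * ((cs.simple i * cs.simple j) ^ k)⁻¹ = u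
        ↔ t = ((cs.simple i * cs.simple j) ^ k)⁻¹ * u * (cs.simple i * cs.simple j) ^ k := by
      intro u
      constructor
      · rintro rfl; group
      · intro h; rw [h]; group
    rw [pow_succ' (signedConj cs i * signedConj cs j)]
    change signedConj cs i (signedConj cs j
      (((signedConj cs i * signedConj cs j) ^ k : Function.End (W × ZMod 2)) (t, e))) = _
    rw [ih]
    simp only [signedConj]
    refine Prod.ext ?_ ?_
    · simp [pow_succ', mul_assoc]
    · have h1 : (cs.simple i * cs.simple j) ^ k * t * ((cs.simple i * cs.simple j) ^ k)⁻¹ =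
          cs.simple j ↔ t = ((cs.simple i * cs.simple j) ^ (2 * k))⁻¹ * cs.simple j := by
        rw [hc, mul_assoc, simple_mul_pow, ← mul_assoc, ← mul_inv_rev, ← pow_add, two_mul]
      have h2 : cs.simple j * ((cs.simple i * cs.simple j) ^ k * t *
          ((cs.simple i * cs.simple j) ^ k)⁻¹) * cs.simple j = cs.simple i ↔
          t = ((cs.simple i * cs.simple j) ^ (2 * k + 1))⁻¹ * cs.simple j := by
        have h3 : ∀ u : W, cs.simple j * u * cs.simple j = cs.simple i ↔
            u = cs.simple j * cs.simple i * cs.simple j := by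
          intro u
          constructor
          · intro h; rw [← h]; simp [mul_assoc]
          · rintro rfl; simp [mul_assoc]
        rw [h3, hc, mul_assoc, mul_assoc, simple_mul_pow,
          show 2 * k + 1 = k + 1 + k by ring, pow_add, pow_succ]
        simp [mul_assoc]
      rw [show 2 * (k + 1) = 2 * k + 1 + 1 by ring, Finset.sum_range_succ, Finset.sum_range_succ]
      simp only [h1, h2, add_assoc]

theorem isLiftable_signedConj : M.IsLiftable (signedConj cs) := by
  classical
  intro i j
  funext ⟨t, e⟩
  rw [signedConj_mul_pow_apply, two_mul, Finset.sum_range_add]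
  simp only [pow_add, cs.simple_mul_simple_pow, one_mul, inv_one, mul_one]
  rw [← two_mul, show (2 : ZMod 2) = 0 from rfl]
  simp [Function.End.one_def]

open Classical in
theorem lift_signedConj_wordProd (ω : List B) (t : W) (e : ZMod 2) :
    cs.lift ⟨signedConj cs, isLiftable_signedConj cs⟩ (cs.wordProd ω) (t, e) =
      (cs.wordProd ω * t * (cs.wordProd ω)⁻¹, e + ((cs.rightInvSeq ω).count t : ℕ)) := by
  induction ω with
  | nil => simp [Function.End.one_def]
  | cons i ω ih =>
    rw [cs.wordProd_cons, map_mul, cs.lift_apply_simple]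
    change signedConj cs i (cs.lift ⟨signedConj cs, isLiftable_signedConj cs⟩
      (cs.wordProd ω) (t, e)) = _
    rw [ih]
    simp only [signedConj, CoxeterSystem.rightInvSeq, List.count_cons]
    refine Prod.ext ?_ ?_
    · simp [mul_assoc]
    · have h : cs.wordProd ω * t * (cs.wordProd ω)⁻¹ = cs.simple i ↔
          (cs.wordProd ω)⁻¹ * cs.simple i * cs.wordProd ω = t := by
        constructor
        · intro h; rw [← h]; group
        · rintro rfl; group
      simp only [h, beq_iff_eq, add_assoc]
      split_ifs <;> simp

theorem simple_mem_rightInvSeq {ω : List B} {i : B}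
    (h : cs.IsRightDescent (cs.wordProd ω) i) : cs.simple i ∈ cs.rightInvSeq ω := by
  classical
  obtain ⟨ω', hω', hv⟩ := cs.exists_isReduced (cs.wordProd ω * cs.simple i)
  have hprod : cs.wordProd (ω'.concat i) = cs.wordProd ω := by
    rw [cs.wordProd_concat, ← hv]; simp
  have hnot : cs.simple i ∉ cs.rightInvSeq ω' := by
    intro hmem
    have h1 := (cs.isRightInversion_of_mem_rightInvSeq hω' hmem).2
    rw [← hv, cs.simple_mul_simple_cancel_right] at h1
    exact absurd h (not_lt.mpr h1.le)
  have h1 := lift_signedConj_wordProd cs (ω'.concat i) (cs.simple i) 0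
  rw [hprod, lift_signedConj_wordProd, Prod.mk.injEq] at h1
  have h2 := h1.2
  rw [cs.rightInvSeq_concat, List.concat_eq_append, List.count_append,
    List.count_eq_zero_of_not_mem (l := List.map _ _)] at h2
  · by_contra hcon
    rw [List.count_eq_zero_of_not_mem hcon] at h2
    simp at h2
  · intro hmem
    obtain ⟨t, ht, hte⟩ := List.mem_map.mp hmem
    have : t = cs.simple i := by
      have := congrArg (fun x => cs.simple i * x * cs.simple i) hte
      simpa [mul_assoc] using this
    exact hnot (this ▸ ht)

theorem simple_mem_leftInvSeq {ω : List B} {i : B}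
    (h : cs.IsLeftDescent (cs.wordProd ω) i) : cs.simple i ∈ cs.leftInvSeq ω := by
  have h1 : cs.IsRightDescent (cs.wordProd ω.reverse) i := by
    rw [cs.wordProd_reverse, ← cs.isLeftDescent_inv_iff, inv_inv]; exact h
  have h2 := simple_mem_rightInvSeq cs h1
  rw [cs.rightInvSeq_reverse] at h2
  simpa using h2

/-- The exchange condition. -/
theorem exists_eraseIdx_of_isLeftDescent {ω : List B} {i : B}
    (h : cs.IsLeftDescent (cs.wordProd ω) i) :
    ∃ j < ω.length, cs.simple i * cs.wordProd ω = cs.wordProd (ω.eraseIdx j) := by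
  obtain ⟨j, hj, hje⟩ := List.mem_iff_getElem.mp (simple_mem_leftInvSeq cs h)
  refine ⟨j, by simpa using hj, ?_⟩
  rw [← cs.getD_leftInvSeq_mul_wordProd, List.getD_eq_getElem _ _ hj, hje]

/-- The exchange condition for a product `a * b`, with `b` given by a word. -/
theorem isLeftDescent_or_exists_eraseIdx {a : W} {ω : List B} {i : B}
    (h : cs.IsLeftDescent (a * cs.wordProd ω) i) :
    cs.IsLeftDescent a i ∨
      ∃ j < ω.length, cs.simple i * (a * cs.wordProd ω) = a * cs.wordProd (ω.eraseIdx j) := by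
  obtain ⟨α, hα, rfl⟩ := cs.exists_isReduced a
  rw [← cs.wordProd_append] at h
  obtain ⟨j, hj, hje⟩ := exists_eraseIdx_of_isLeftDescent cs h
  rw [List.length_append] at hj
  rcases lt_or_ge j α.length with hlt | hge
  · left
    rw [List.eraseIdx_append_of_lt_length hlt, cs.wordProd_append, cs.wordProd_append,
      ← mul_assoc] at hje
    rw [CoxeterSystem.IsLeftDescent, mul_right_cancel hje, hα.eq]
    have := cs.length_wordProd_le (α.eraseIdx j)
    have := List.length_eraseIdx_add_one hlt
    omega
  · right
    refine ⟨j - α.length, by omega, ?_⟩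
    rw [List.eraseIdx_append_of_length_le hge, cs.wordProd_append, cs.wordProd_append] at hje
    exact hje

theorem isLeftDescent_or_exists_length_lt {a b : W} {i : B} (h : cs.IsLeftDescent (a * b) i) :
    cs.IsLeftDescent a i ∨ ∃ c, cs.simple i * (a * b) = a * c ∧ cs.length c < cs.length b := by
  obtain ⟨ω, hω, rfl⟩ := cs.exists_isReduced b
  refine (isLeftDescent_or_exists_eraseIdx cs h).imp_right ?_
  rintro ⟨j, hj, hje⟩
  refine ⟨_, hje, ?_⟩
  have := cs.length_wordProd_le (ω.eraseIdx j)
  have := List.length_eraseIdx_add_one hj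
  rw [hω.eq]
  omega

/-! ### Standard parabolic subgroups -/

/-- The word `ω` uses only letters from `I`. -/
def WordIn (I : Set W) (ω : List B) : Prop := ∀ i ∈ ω, cs.simple i ∈ I

/-- `w` has no left descent in `I`. -/
def NoLeftDescent (I : Set W) (w : W) : Prop := ∀ i, cs.simple i ∈ I → ¬ cs.IsLeftDescent w i

variable {cs}

theorem WordIn.wordProd_mem {I : Set W} {ω : List B} (h : WordIn cs I ω) :
    cs.wordProd ω ∈ par I := by
  induction ω with
  | nil => simp
  | cons i ω ih =>
    rw [cs.wordProd_cons]
    exact (par I).mul_mem (Subgroup.subset_closure (h i (by simp)))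
      (ih fun k hk => h k (by simp [hk]))

theorem WordIn.eraseIdx {I : Set W} {ω : List B} (h : WordIn cs I ω) (j : ℕ) :
    WordIn cs I (ω.eraseIdx j) := fun k hk => h k (List.mem_of_mem_eraseIdx hk)

variable (cs)

/-- Multiplying on the left by a simple reflection of `I` preserves the property of having a
reduced word in `I`. -/
theorem exists_reduced_simple_mul {I : Set W} {i : B} (hi : cs.simple i ∈ I) {u : W}
    (hu : ∃ ω, cs.IsReduced ω ∧ WordIn cs I ω ∧ u = cs.wordProd ω) :
    ∃ ω, cs.IsReduced ω ∧ WordIn cs I ω ∧ cs.simple i * u = cs.wordProd ω := by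
  obtain ⟨ω, hω, hωI, rfl⟩ := hu
  by_cases hd : cs.IsLeftDescent (cs.wordProd ω) i
  · obtain ⟨j, hj, hje⟩ := exists_eraseIdx_of_isLeftDescent cs hd
    refine ⟨ω.eraseIdx j, ?_, hωI.eraseIdx j, hje⟩
    have h1 := cs.isLeftDescent_iff.mp hd
    have h2 := List.length_eraseIdx_add_one hj
    rw [hje, hω.eq] at h1
    rw [CoxeterSystem.IsReduced]
    omega
  · refine ⟨i :: ω, ?_, ?_, (cs.wordProd_cons i ω).symm⟩
    · rw [CoxeterSystem.IsReduced, cs.wordProd_cons, cs.not_isLeftDescent_iff.mp hd, hω.eq,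
        List.length_cons]
    · intro k hk
      rcases List.mem_cons.mp hk with rfl | hk
      · exact hi
      · exact hωI k hk

theorem exists_reduced_wordIn {I : Set W} (hI : I ⊆ simpleSet cs) {u : W} (hu : u ∈ par I) :
    ∃ ω, cs.IsReduced ω ∧ WordIn cs I ω ∧ u = cs.wordProd ω := by
  induction hu using Subgroup.closure_induction_left with
  | one => exact ⟨[], by simp [CoxeterSystem.IsReduced], by simp [WordIn], by simp⟩
  | mul_left x hx y hy ih =>
    obtain ⟨i, rfl⟩ := hI hx
    exact exists_reduced_simple_mul cs hx ih
  | inv_mul_cancel x hx y hy ih =>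
    obtain ⟨i, rfl⟩ := hI hx
    rw [cs.inv_simple]
    exact exists_reduced_simple_mul cs hx ih

theorem mem_of_mem_par_of_length_eq_one {I : Set W} (hI : I ⊆ simpleSet cs) {u : W}
    (hu : u ∈ par I) (h1 : cs.length u = 1) : u ∈ I := by
  obtain ⟨ω, hω, hωI, rfl⟩ := exists_reduced_wordIn cs hI hu
  rw [hω.eq] at h1
  obtain ⟨i, rfl⟩ := List.length_eq_one_iff.mp h1
  simpa using hωI i (by simp)

theorem mem_of_simple_mem_par {I : Set W} (hI : I ⊆ simpleSet cs) {i : B}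
    (hu : cs.simple i ∈ par I) : cs.simple i ∈ I :=
  mem_of_mem_par_of_length_eq_one cs hI hu (cs.length_simple i)

/-- Lengths add up for a word in `I` times an element of minimal length in its coset. -/
theorem length_wordProd_mul_of_minimal {I : Set W} {x : W}
    (hx : ∀ u ∈ par I, cs.length x ≤ cs.length (u * x)) {ω : List B} (hω : cs.IsReduced ω)
    (hωI : WordIn cs I ω) : cs.length (cs.wordProd ω * x) = ω.length + cs.length x := by
  induction ω with
  | nil => simp
  | cons i ω ih =>
    have hω' : cs.IsReduced ω := hω.drop 1
    have hωI' : WordIn cs I ω := fun k hk => hωI k (by simp [hk])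
    have ih' := ih hω' hωI'
    rw [cs.wordProd_cons, mul_assoc, List.length_cons]
    by_cases hd : cs.IsLeftDescent (cs.wordProd ω * x) i
    · exfalso
      rcases isLeftDescent_or_exists_length_lt cs hd with h | ⟨c, hc, hlt⟩
      · rw [CoxeterSystem.IsLeftDescent, ← cs.wordProd_cons, hω.eq, hω'.eq,
          List.length_cons] at h
        omega
      · have hci : c = (cs.wordProd ω)⁻¹ * cs.simple i * cs.wordProd ω * x := by
          rw [mul_assoc, mul_assoc, hc]; group
        have hmem : (cs.wordProd ω)⁻¹ * cs.simple i * cs.wordProd ω ∈ par I :=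
          (par I).mul_mem ((par I).mul_mem ((par I).inv_mem hωI'.wordProd_mem)
            (Subgroup.subset_closure (hωI i (by simp)))) hωI'.wordProd_mem
        have := hx _ hmem
        rw [← hci] at this
        omega
    · rw [cs.not_isLeftDescent_iff.mp hd, ih']
      ring

/-- Every element is the product of an element of `W_I` and an element of minimal length in its
coset, which has no left descent in `I`. -/
theorem exists_minimal_coset_rep (I : Set W) (w : W) :
    ∃ u ∈ par I, ∃ x, w = u * x ∧ ∀ a ∈ par I, cs.length x ≤ cs.length (a * x) := by
  have hne : {n | ∃ u ∈ par I, cs.length (u * w) = n}.Nonempty := ⟨_, 1, (par I).one_mem, rfl⟩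
  obtain ⟨u, hu, hun⟩ := Nat.sInf_mem hne
  refine ⟨u⁻¹, (par I).inv_mem hu, u * w, by group, fun a ha => ?_⟩
  rw [hun]
  exact Nat.sInf_le ⟨a * u, (par I).mul_mem ha hu, by rw [mul_assoc]⟩

theorem length_mul_of_minimal {I : Set W} (hI : I ⊆ simpleSet cs) {x : W}
    (hx : ∀ u ∈ par I, cs.length x ≤ cs.length (u * x)) {u : W} (hu : u ∈ par I) :
    cs.length (u * x) = cs.length u + cs.length x := by
  obtain ⟨ω, hω, hωI, rfl⟩ := exists_reduced_wordIn cs hI hu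
  rw [length_wordProd_mul_of_minimal cs hx hω hωI, hω.eq]

theorem NoLeftDescent.length_mul {cs : CoxeterSystem M W} {I : Set W} (hI : I ⊆ simpleSet cs)
    {w : W} (hw : NoLeftDescent cs I w) {u : W} (hu : u ∈ par I) :
    cs.length (u * w) = cs.length u + cs.length w := by
  obtain ⟨a, ha, x, rfl, hx⟩ := exists_minimal_coset_rep cs I w
  obtain ⟨ω, hω, hωI, rfl⟩ := exists_reduced_wordIn cs hI ha
  cases ω with
  | nil => simpa using length_mul_of_minimal cs hI hx hu
  | cons i ω =>
    exfalso
    refine hw i (hωI i (by simp)) ?_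
    have hω' : cs.IsReduced ω := hω.drop 1
    rw [CoxeterSystem.IsLeftDescent, length_wordProd_mul_of_minimal cs hx hω hωI,
      cs.wordProd_cons, mul_assoc, cs.simple_mul_simple_cancel_left,
      length_wordProd_mul_of_minimal cs hx hω' fun k hk => hωI k (by simp [hk])]
    simp

/-- Lengths add up on the right if `w⁻¹` has no left descent in `I`. -/
theorem NoLeftDescent.length_mul_right {cs : CoxeterSystem M W} {I : Set W}
    (hI : I ⊆ simpleSet cs) {w : W} (hw : NoLeftDescent cs I w⁻¹) {u : W} (hu : u ∈ par I) :
    cs.length (w * u) = cs.length w + cs.length u := by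
  have := hw.length_mul hI ((par I).inv_mem hu)
  rw [← mul_inv_rev, cs.length_inv, cs.length_inv, cs.length_inv] at this
  omega

/-! ### Longest elements -/

/-- If every simple reflection of `I` is a left descent of `v`, then every element of `W_I` is a
prefix of `v`. -/
theorem length_inv_mul_add_of_descents {I : Set W} (hI : I ⊆ simpleSet cs) {v : W}
    (hv : ∀ i, cs.simple i ∈ I → cs.IsLeftDescent v i) {a : W} (ha : a ∈ par I) :
    cs.length (a⁻¹ * v) + cs.length a = cs.length v := by
  obtain ⟨ω, hω, hωI, rfl⟩ := exists_reduced_wordIn cs hI ha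
  induction ω with
  | nil => simp
  | cons i ω ih =>
    have hω' : cs.IsReduced ω := hω.drop 1
    have hωI' : WordIn cs I ω := fun k hk => hωI k (by simp [hk])
    have ih' := ih hω' hωI' hωI'.wordProd_mem
    have hd := hv i (hωI i (by simp))
    rw [show v = cs.wordProd ω * ((cs.wordProd ω)⁻¹ * v) by group] at hd
    rcases isLeftDescent_or_exists_length_lt cs hd with h | ⟨c, hc, hlt⟩
    · rw [CoxeterSystem.IsLeftDescent, ← cs.wordProd_cons, hω.eq, hω'.eq,
        List.length_cons] at h
      omega
    · have hce : (cs.wordProd (i :: ω))⁻¹ * v = c := by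
        have : c = (cs.wordProd ω)⁻¹ * (cs.simple i * v) := by
          rw [show v = cs.wordProd ω * ((cs.wordProd ω)⁻¹ * v) by group, hc]; group
        rw [this, cs.wordProd_cons]
        simp [mul_assoc]
      have h1 := cs.length_le_length_mul_add_left (cs.wordProd (i :: ω))⁻¹ v
      rw [cs.length_inv, hce] at h1
      rw [hce]
      rw [hω.eq] at h1 ⊢
      rw [hω'.eq] at ih'
      rw [List.length_cons] at h1 ⊢
      omega

theorem IsLongest.isLeftDescent {cs : CoxeterSystem M W} {I : Set W} {v : W}
    (hv : IsLongest cs I v) (i : B) (hi : cs.simple i ∈ I) : cs.IsLeftDescent v i := by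
  by_contra h
  have h1 := cs.not_isLeftDescent_iff.mp h
  have := hv.2 _ ((par I).mul_mem (Subgroup.subset_closure hi) hv.1)
  omega

theorem IsLongest.length_mul_add {cs : CoxeterSystem M W} {I : Set W} (hI : I ⊆ simpleSet cs)
    {v : W} (hv : IsLongest cs I v) {a : W} (ha : a ∈ par I) :
    cs.length (a * v) + cs.length a = cs.length v := by
  have := length_inv_mul_add_of_descents cs hI hv.isLeftDescent ((par I).inv_mem ha)
  rwa [inv_inv, cs.length_inv] at this

theorem IsLongest.inv {cs : CoxeterSystem M W} {I : Set W} {v : W} (hv : IsLongest cs I v) :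
    IsLongest cs I v⁻¹ :=
  ⟨(par I).inv_mem hv.1, fun u hu => by rw [cs.length_inv]; exact hv.2 u hu⟩

theorem IsLongest.unique {cs : CoxeterSystem M W} {I : Set W} (hI : I ⊆ simpleSet cs) {v v' : W}
    (hv : IsLongest cs I v) (hv' : IsLongest cs I v') : v = v' := by
  have h1 := hv.length_mul_add hI ((par I).inv_mem hv'.1)
  have h2 := hv'.2 v hv.1
  rw [cs.length_inv] at h1
  have h3 : cs.length (v'⁻¹ * v) = 0 := by
    have := hv.2 v' hv'.1
    omega
  rw [cs.length_eq_zero_iff, inv_mul_eq_one] at h3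
  exact h3.symm

theorem IsLongest.mul_self {cs : CoxeterSystem M W} {I : Set W} (hI : I ⊆ simpleSet cs) {v : W}
    (hv : IsLongest cs I v) : v * v = 1 := by
  exact mul_eq_one_iff_eq_inv.mpr (hv.unique hI hv.inv)

theorem IsLongest.length_mul_right_add {cs : CoxeterSystem M W} {I : Set W}
    (hI : I ⊆ simpleSet cs) {v : W} (hv : IsLongest cs I v) {a : W} (ha : a ∈ par I) :
    cs.length (v * a) + cs.length a = cs.length v := by
  have := hv.inv.length_mul_add hI ((par I).inv_mem ha)
  rwa [← mul_inv_rev, cs.length_inv, cs.length_inv, cs.length_inv] at this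

theorem isLongest_longest {I : Set W} (hfin : (par I : Set W).Finite) :
    IsLongest cs I (longest cs I) := by
  obtain ⟨v, hv, hmax⟩ := hfin.exists_maximalFor cs.length _ ⟨1, (par I).one_mem⟩
  have hex : ∃ w, IsLongest cs I w :=
    ⟨v, hv, fun u hu => (le_total (cs.length u) (cs.length v)).elim id fun h => hmax hu h⟩
  rw [longest, dif_pos hex]
  exact hex.choose_spec

/-- A finite set of simple reflections all of which are left descents of a common element
generates a finite group, the longest element of which is a prefix of that element. -/
theorem finite_par_of_descents {I : Set W} (hI : I ⊆ simpleSet cs) (hfin : I.Finite) {v : W}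
    (hv : ∀ i, cs.simple i ∈ I → cs.IsLeftDescent v i) : (par I : Set W).Finite := by
  have : Finite I := hfin
  have hl := List.finite_length_le I (cs.length v)
  refine (hl.image fun l : List I => (l.map Subtype.val).prod).subset ?_
  intro a ha
  have hlen := length_inv_mul_add_of_descents cs hI hv ha
  obtain ⟨ω, hω, hωI, rfl⟩ := exists_reduced_wordIn cs hI ha
  replace hωI : ∀ i ∈ ω, cs.simple i ∈ I := hωI
  refine ⟨ω.pmap (fun i hi => ⟨cs.simple i, hi⟩) hωI, ?_, ?_⟩
  · rw [hω.eq] at hlen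
    change (ω.pmap _ hωI).length ≤ _
    rw [List.length_pmap]
    omega
  · simp only [List.map_pmap, List.pmap_eq_map, CoxeterSystem.wordProd]

/-! ### The group `W̃` -/

/-- `w` normalises `W_I`. -/
def Normalizes (I : Set W) (w : W) : Prop := ∀ u, w * u * w⁻¹ ∈ par I ↔ u ∈ par I

theorem Normalizes.inv {I : Set W} {w : W} (h : Normalizes I w) : Normalizes I w⁻¹ := by
  intro u
  rw [← h]
  group

theorem Normalizes.mul {I : Set W} {w v : W} (hw : Normalizes I w) (hv : Normalizes I v) :
    Normalizes I (w * v) := by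
  intro u
  rw [← hv u, ← hw (v * u * v⁻¹)]
  group

theorem normalizes_of_mem {I : Set W} {w : W} (h : w ∈ par I) : Normalizes I w := by
  intro u
  rw [(par I).mul_mem_cancel_right ((par I).inv_mem h), (par I).mul_mem_cancel_left h]

theorem image_conj_eq_iff {I : Set W} {w : W} :
    (fun u => w * u * w⁻¹) '' (par I : Set W) = (par I : Set W) ↔ Normalizes I w := by
  constructor
  · intro h u
    rw [← SetLike.mem_coe, ← h, Set.mem_image, ← SetLike.mem_coe]
    constructor
    · rintro ⟨v, hv, hve⟩
      simpa using (mul_left_cancel (mul_right_cancel hve)) ▸ hv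
    · exact fun hu => ⟨u, hu, rfl⟩
  · intro h
    ext v
    constructor
    · rintro ⟨u, hu, rfl⟩
      exact (h u).mpr hu
    · exact fun hv => ⟨w⁻¹ * v * w, by simpa using (h.inv v).mpr hv, by group⟩

theorem mem_relW_iff {Sg : Set W} (hS : Sg ⊆ simpleSet cs) {w : W} :
    w ∈ relW cs Sg ↔ Normalizes Sg w ∧ NoLeftDescent cs Sg w := by
  refine and_congr image_conj_eq_iff ⟨fun h i hi hd => ?_, fun h => ?_⟩
  · refine Set.eq_empty_iff_forall_notMem.mp h (cs.simple i) ⟨⟨⟨1, i, by simp⟩, hd⟩, ?_⟩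
    exact ⟨1, (par Sg).one_mem, _, hi, by simp⟩
  · refine Set.eq_empty_iff_forall_notMem.mpr ?_
    rintro t ⟨⟨-, hlt⟩, u, hu, s, hs, rfl⟩
    rw [h.length_mul hS ((par Sg).mul_mem ((par Sg).mul_mem hu (Subgroup.subset_closure hs))
      ((par Sg).inv_mem hu))] at hlt
    omega

variable {cs}

theorem relW_conj_mem {Sg : Set W} (hS : Sg ⊆ simpleSet cs) {w : W} (hw : w ∈ relW cs Sg) {u : W}
    (hu : u ∈ par Sg) : w * u * w⁻¹ ∈ par Sg :=
  (((mem_relW_iff cs hS).mp hw).1 u).mpr hu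

theorem relW_length_mul_left {Sg : Set W} (hS : Sg ⊆ simpleSet cs) {w : W} (hw : w ∈ relW cs Sg)
    {u : W} (hu : u ∈ par Sg) : cs.length (u * w) = cs.length u + cs.length w :=
  ((mem_relW_iff cs hS).mp hw).2.length_mul hS hu

theorem relW_inv {Sg : Set W} (hS : Sg ⊆ simpleSet cs) {w : W} (hw : w ∈ relW cs Sg) :
    w⁻¹ ∈ relW cs Sg := by
  refine (mem_relW_iff cs hS).mpr ⟨((mem_relW_iff cs hS).mp hw).1.inv, fun i hi hd => ?_⟩
  rw [cs.isLeftDescent_inv_iff, CoxeterSystem.IsRightDescent,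
    show w * cs.simple i = w * cs.simple i * w⁻¹ * w by group,
    relW_length_mul_left hS hw (relW_conj_mem hS hw (Subgroup.subset_closure hi))] at hd
  omega

theorem relW_length_mul_right {Sg : Set W} (hS : Sg ⊆ simpleSet cs) {w : W} (hw : w ∈ relW cs Sg)
    {u : W} (hu : u ∈ par Sg) : cs.length (w * u) = cs.length w + cs.length u :=
  ((mem_relW_iff cs hS).mp (relW_inv hS hw)).2.length_mul_right hS hu

theorem relW_length_conj {Sg : Set W} (hS : Sg ⊆ simpleSet cs) {w : W} (hw : w ∈ relW cs Sg)
    {u : W} (hu : u ∈ par Sg) : cs.length (w * u * w⁻¹) = cs.length u := by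
  have h1 := relW_length_mul_left hS hw (relW_conj_mem hS hw hu)
  have h2 := relW_length_mul_right hS hw hu
  rw [inv_mul_cancel_right] at h1
  omega

theorem relW_one {Sg : Set W} (hS : Sg ⊆ simpleSet cs) : (1 : W) ∈ relW cs Sg := by
  refine (mem_relW_iff cs hS).mpr ⟨normalizes_of_mem (par Sg).one_mem, fun i _ hd => ?_⟩
  simp [CoxeterSystem.IsLeftDescent] at hd

theorem relW_mul {Sg : Set W} (hS : Sg ⊆ simpleSet cs) {w v : W} (hw : w ∈ relW cs Sg)
    (hv : v ∈ relW cs Sg) : w * v ∈ relW cs Sg := by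
  have hw' := (mem_relW_iff cs hS).mp hw
  have hv' := (mem_relW_iff cs hS).mp hv
  refine (mem_relW_iff cs hS).mpr ⟨hw'.1.mul hv'.1, fun i hi hd => ?_⟩
  rcases isLeftDescent_or_exists_length_lt cs hd with h | ⟨c, hc, hlt⟩
  · exact hw'.2 i hi h
  · have h1 := relW_length_mul_left hS hv (relW_conj_mem hS (relW_inv hS hw)
      (Subgroup.subset_closure hi))
    have h2 : c = w⁻¹ * cs.simple i * w⁻¹⁻¹ * v := by
      rw [← inv_mul_cancel_left w c, ← hc]; group
    rw [← h2] at h1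
    omega

/-- Elements of `W̃` commute with the longest element of `W_Σ`. -/
theorem relW_conj_longest {Sg : Set W} (hS : Sg ⊆ simpleSet cs) {w : W} (hw : w ∈ relW cs Sg)
    {v : W} (hv : IsLongest cs Sg v) : w * v * w⁻¹ = v := by
  refine IsLongest.unique hS ⟨relW_conj_mem hS hw hv.1, fun u hu => ?_⟩ hv
  rw [relW_length_conj hS hw hv.1]
  exact hv.2 u hu

/-! ### The generators `s̃` -/

theorem union_subset_simpleSet {Sg : Set W} (hS : Sg ⊆ simpleSet cs) (i : B) :
    Sg ∪ {cs.simple i} ⊆ simpleSet cs := by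
  rintro x (hx | rfl)
  · exact hS hx
  · exact ⟨i, rfl⟩

theorem longest_union_eq_tilde_mul {Sg : Set W} (hSg : GoodSubset cs Sg) (s : W) :
    longest cs (Sg ∪ {s}) = tilde cs Sg s * longest cs Sg := by
  rw [tilde, mul_assoc, (isLongest_longest cs hSg.2.1).mul_self hSg.1, mul_one]

theorem length_tilde_add {Sg : Set W} (hSg : GoodSubset cs Sg) {i : B}
    (hi : cs.simple i ∈ complSet cs Sg) :
    cs.length (tilde cs Sg (cs.simple i)) + cs.length (longest cs Sg) =
      cs.length (longest cs (Sg ∪ {cs.simple i})) :=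
  (isLongest_longest cs hi.2).length_mul_right_add (union_subset_simpleSet hSg.1 i)
    (Subgroup.closure_mono Set.subset_union_left (isLongest_longest cs hSg.2.1).1)

theorem tilde_mem_relW {Sg : Set W} (hSg : GoodSubset cs Sg) {i : B}
    (hi : cs.simple i ∈ complSet cs Sg) : tilde cs Sg (cs.simple i) ∈ relW cs Sg := by
  have hJ := union_subset_simpleSet hSg.1 i
  have hmono : par Sg ≤ par (Sg ∪ {cs.simple i}) := Subgroup.closure_mono Set.subset_union_left
  have hlong := isLongest_longest cs hi.2
  have hv := isLongest_longest cs hSg.2.1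
  have hnorm : Normalizes Sg (longest cs (Sg ∪ {cs.simple i})) :=
    image_conj_eq_iff.mp (hSg.2.2 _ Set.subset_union_left hJ hi.2 _ hlong)
  refine (mem_relW_iff cs hSg.1).mpr ⟨hnorm.mul (normalizes_of_mem hv.1), fun j hj hd => ?_⟩
  have hmem : (longest cs (Sg ∪ {cs.simple i}))⁻¹ * cs.simple j *
      (longest cs (Sg ∪ {cs.simple i}))⁻¹⁻¹ * longest cs Sg ∈ par Sg :=
    (par Sg).mul_mem ((hnorm.inv _).mpr (Subgroup.subset_closure hj)) hv.1
  have h1 := hlong.length_mul_right_add hJ (hmono hmem)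
  have h2 := length_tilde_add hSg hi
  have h3 := hv.2 _ hmem
  rw [show longest cs (Sg ∪ {cs.simple i}) * ((longest cs (Sg ∪ {cs.simple i}))⁻¹ *
    cs.simple j * (longest cs (Sg ∪ {cs.simple i}))⁻¹⁻¹ * longest cs Sg) =
      cs.simple j * tilde cs Sg (cs.simple i) by rw [tilde]; group] at h1
  rw [CoxeterSystem.IsLeftDescent] at hd
  omega

theorem tilde_mul_self {Sg : Set W} (hSg : GoodSubset cs Sg) {i : B}
    (hi : cs.simple i ∈ complSet cs Sg) :
    tilde cs Sg (cs.simple i) * tilde cs Sg (cs.simple i) = 1 := by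
  have hv := isLongest_longest cs hSg.2.1
  have h1 := relW_conj_longest hSg.1 (tilde_mem_relW hSg hi) hv
  have h2 := (isLongest_longest cs hi.2).mul_self (union_subset_simpleSet hSg.1 i)
  have h3 := hv.mul_self hSg.1
  rw [mul_inv_eq_iff_eq_mul] at h1
  rw [longest_union_eq_tilde_mul hSg] at h2
  rw [← h2, mul_assoc _ (longest cs Sg), ← mul_assoc (longest cs Sg), ← h1,
    mul_assoc _ (longest cs Sg), h3, mul_one]

theorem tilde_mem_par {Sg : Set W} (hSg : GoodSubset cs Sg) {i : B}
    (hi : cs.simple i ∈ complSet cs Sg) :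
    tilde cs Sg (cs.simple i) ∈ par (Sg ∪ {cs.simple i}) :=
  (par _).mul_mem (isLongest_longest cs hi.2).1
    (Subgroup.closure_mono Set.subset_union_left (isLongest_longest cs hSg.2.1).1)

theorem length_tilde_pos {Sg : Set W} (hSg : GoodSubset cs Sg) {i : B}
    (hi : cs.simple i ∈ complSet cs Sg) : 0 < cs.length (tilde cs Sg (cs.simple i)) := by
  by_contra hcon
  have h1 := cs.length_eq_zero_iff.mp (Nat.eq_zero_of_not_pos hcon)
  have h2 := longest_union_eq_tilde_mul hSg (cs.simple i)
  rw [h1, one_mul] at h2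
  have hd := (isLongest_longest cs hi.2).isLeftDescent i (Or.inr rfl)
  rw [h2] at hd
  obtain ⟨ω, -, hωI, hω⟩ := exists_reduced_wordIn cs hSg.1 (isLongest_longest cs hSg.2.1).1
  rw [hω] at hd
  obtain ⟨j, -, hj⟩ := exists_eraseIdx_of_isLeftDescent cs hd
  have hmem : cs.simple i * cs.wordProd ω ∈ par Sg := hj ▸ (hωI.eraseIdx j).wordProd_mem
  rw [(par Sg).mul_mem_cancel_right hωI.wordProd_mem] at hmem
  exact hi.1.2 (mem_of_simple_mem_par cs hSg.1 hmem)

theorem relW_noLeftDescent_union {Sg : Set W} (hSg : GoodSubset cs Sg) {w : W}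
    (hw : w ∈ relW cs Sg) {i : B} (hd : ¬ cs.IsLeftDescent w i) :
    NoLeftDescent cs (Sg ∪ {cs.simple i}) w := by
  rintro j (hj | hj)
  · exact ((mem_relW_iff cs hSg.1).mp hw).2 j hj
  · rw [CoxeterSystem.IsLeftDescent, Set.mem_singleton_iff.mp hj]
    exact hd

theorem length_tilde_mul_of_not_isLeftDescent {Sg : Set W} (hSg : GoodSubset cs Sg) {w : W}
    (hw : w ∈ relW cs Sg) {i : B} (hi : cs.simple i ∈ complSet cs Sg)
    (hd : ¬ cs.IsLeftDescent w i) :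
    cs.length (tilde cs Sg (cs.simple i) * w) =
      cs.length w + cs.length (tilde cs Sg (cs.simple i)) := by
  rw [(relW_noLeftDescent_union hSg hw hd).length_mul (union_subset_simpleSet hSg.1 i)
    (tilde_mem_par hSg hi), add_comm]

/-- A left descent of an element of `W̃` lies in `Σ^∁`, and the corresponding generator `s̃` can be
split off from the left. -/
theorem isLeftDescent_relW {Sg : Set W} (hSg : GoodSubset cs Sg) {w : W}
    (hw : w ∈ relW cs Sg) {i : B} (hd : cs.IsLeftDescent w i) :
    cs.simple i ∈ complSet cs Sg ∧ cs.length (tilde cs Sg (cs.simple i) * w) +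
      cs.length (tilde cs Sg (cs.simple i)) = cs.length w := by
  have hJ := union_subset_simpleSet hSg.1 i
  have hv := isLongest_longest cs hSg.2.1
  have hcomm := relW_conj_longest hSg.1 hw hv
  rw [mul_inv_eq_iff_eq_mul] at hcomm
  have hlen := relW_length_mul_left hSg.1 hw hv.1
  have hdesc : ∀ j, cs.simple j ∈ Sg ∪ {cs.simple i} →
      cs.IsLeftDescent (longest cs Sg * w) j := by
    rintro j (hj | hj)
    · have h1 := hv.isLeftDescent j hj
      rw [CoxeterSystem.IsLeftDescent] at h1 ⊢
      rw [hlen, ← mul_assoc, relW_length_mul_left hSg.1 hw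
        ((par Sg).mul_mem (Subgroup.subset_closure hj) hv.1)]
      omega
    · rw [CoxeterSystem.IsLeftDescent] at hd ⊢
      rw [hlen, Set.mem_singleton_iff.mp hj, ← hcomm, ← mul_assoc]
      have := cs.length_mul_le (cs.simple i * w) (longest cs Sg)
      omega
  have hi : cs.simple i ∈ complSet cs Sg := by
    refine ⟨⟨⟨i, rfl⟩, fun h => ((mem_relW_iff cs hSg.1).mp hw).2 i h hd⟩, ?_⟩
    refine finite_par_of_descents cs hJ (Set.Finite.union ?_ (Set.finite_singleton _)) hdesc
    exact hSg.2.1.subset Subgroup.subset_closure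
  refine ⟨hi, ?_⟩
  have hlong := isLongest_longest cs hi.2
  have h1 := length_inv_mul_add_of_descents cs hJ hdesc hlong.1
  have h2 : (longest cs (Sg ∪ {cs.simple i}))⁻¹ * (longest cs Sg * w) =
      tilde cs Sg (cs.simple i) * w := by
    rw [← hlong.unique hJ hlong.inv, tilde, mul_assoc]
  have h3 := length_tilde_add hSg hi
  rw [h2, hlen] at h1
  omega

/-- The folding property: if `s̃` becomes a descent when passing from `x` to `x r̃`, then
`s̃ x = x r̃`. -/
theorem tilde_mul_eq_mul_tilde {Sg : Set W} (hSg : GoodSubset cs Sg) {x : W}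
    (hx : x ∈ relW cs Sg) {i j : B} (hi : cs.simple i ∈ complSet cs Sg)
    (hj : cs.simple j ∈ complSet cs Sg) (hd : ¬ cs.IsLeftDescent x i)
    (hd' : cs.IsLeftDescent (x * tilde cs Sg (cs.simple j)) i) :
    tilde cs Sg (cs.simple i) * x = x * tilde cs Sg (cs.simple j) := by
  have hI := union_subset_simpleSet hSg.1 i
  have hJ := union_subset_simpleSet hSg.1 j
  have hmonoI : par Sg ≤ par (Sg ∪ {cs.simple i}) := Subgroup.closure_mono Set.subset_union_left
  have hmonoJ : par Sg ≤ par (Sg ∪ {cs.simple j}) := Subgroup.closure_mono Set.subset_union_left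
  have hxi := relW_inv hSg.1 hx
  have hleft := relW_noLeftDescent_union hSg hx hd
  have hright : NoLeftDescent cs (Sg ∪ {cs.simple j}) x⁻¹ := by
    refine relW_noLeftDescent_union hSg hxi fun h => hd ?_
    have h1 := (isLeftDescent_relW hSg hxi h).2
    have h2 : tilde cs Sg (cs.simple j) * x⁻¹ = (x * tilde cs Sg (cs.simple j))⁻¹ := by
      rw [mul_inv_rev, ← mul_eq_one_iff_eq_inv.mp (tilde_mul_self hSg hj)]
    rw [h2, cs.length_inv, cs.length_inv] at h1
    have h3 := cs.length_mul_le (cs.simple i * (x * tilde cs Sg (cs.simple j)))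
      (tilde cs Sg (cs.simple j))
    rw [mul_assoc, mul_assoc, tilde_mul_self hSg hj, mul_one] at h3
    rw [CoxeterSystem.IsLeftDescent] at hd' ⊢
    omega
  have hconj : x⁻¹ * cs.simple i * x ∈ par (Sg ∪ {cs.simple j}) := by
    have htj := tilde_mem_par hSg hj
    obtain ⟨ω, -, hωJ, hω⟩ := exists_reduced_wordIn cs hJ htj
    rw [hω] at hd'
    rcases isLeftDescent_or_exists_eraseIdx cs hd' with h | ⟨k, -, hk⟩
    · exact absurd h hd
    · rw [← (par _).mul_mem_cancel_right hωJ.wordProd_mem]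
      have h1 : x⁻¹ * cs.simple i * x * cs.wordProd ω = cs.wordProd (ω.eraseIdx k) := by
        rw [← inv_mul_cancel_left x (cs.wordProd (ω.eraseIdx k)), ← hk]; group
      rw [h1]
      exact (hωJ.eraseIdx k).wordProd_mem
  have hlenconj : ∀ a ∈ par (Sg ∪ {cs.simple i}), x⁻¹ * a * x ∈ par (Sg ∪ {cs.simple j}) →
      cs.length (x⁻¹ * a * x) = cs.length a := by
    intro a ha ha'
    have h1 := hleft.length_mul hI ha
    have h2 := hright.length_mul_right hJ ha'
    rw [show x * (x⁻¹ * a * x) = a * x by group] at h2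
    omega
  have hij : x⁻¹ * cs.simple i * x = cs.simple j := by
    have h1 := hlenconj _ (Subgroup.subset_closure (Or.inr rfl)) hconj
    rw [cs.length_simple] at h1
    rcases mem_of_mem_par_of_length_eq_one cs hJ hconj h1 with h | h
    · exfalso
      have h2 := relW_conj_mem hSg.1 hx (Subgroup.subset_closure h)
      rw [show x * (x⁻¹ * cs.simple i * x) * x⁻¹ = cs.simple i by group] at h2
      exact hi.1.2 (mem_of_simple_mem_par cs hSg.1 h2)
    · exact h
  have hto : ∀ a ∈ par (Sg ∪ {cs.simple i}), x⁻¹ * a * x ∈ par (Sg ∪ {cs.simple j}) := by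
    have : par (Sg ∪ {cs.simple i}) ≤
        (par (Sg ∪ {cs.simple j})).comap (MulAut.conj x⁻¹).toMonoidHom := by
      refine (Subgroup.closure_le _).mpr ?_
      rintro a (ha | ha)
      · simpa using hmonoJ (relW_conj_mem hSg.1 hxi (Subgroup.subset_closure ha))
      · rw [Set.mem_singleton_iff.mp ha]
        simpa using hconj
    intro a ha
    simpa using this ha
  have hfrom : ∀ b ∈ par (Sg ∪ {cs.simple j}), x * b * x⁻¹ ∈ par (Sg ∪ {cs.simple i}) := by
    have : par (Sg ∪ {cs.simple j}) ≤
        (par (Sg ∪ {cs.simple i})).comap (MulAut.conj x).toMonoidHom := by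
      refine (Subgroup.closure_le _).mpr ?_
      rintro b (hb | hb)
      · simpa using hmonoI (relW_conj_mem hSg.1 hx (Subgroup.subset_closure hb))
      · rw [Set.mem_singleton_iff.mp hb, ← hij]
        have h : cs.simple i ∈ par (Sg ∪ {cs.simple i}) := Subgroup.subset_closure (Or.inr rfl)
        simpa [mul_assoc] using h
    intro b hb
    simpa using this hb
  have hlongI := isLongest_longest cs hi.2
  have hlong : x⁻¹ * longest cs (Sg ∪ {cs.simple i}) * x = longest cs (Sg ∪ {cs.simple j}) := by
    refine IsLongest.unique hJ ⟨hto _ hlongI.1, fun b hb => ?_⟩ (isLongest_longest cs hj.2)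
    have hb' : x⁻¹ * (x * b * x⁻¹) * x = b := by group
    have h1 := hlenconj _ (hfrom b hb) (by rwa [hb'])
    rw [hb'] at h1
    rw [hlenconj _ hlongI.1 (hto _ hlongI.1), h1]
    exact hlongI.2 _ (hfrom b hb)
  have hv := relW_conj_longest hSg.1 hxi (isLongest_longest cs hSg.2.1)
  rw [tilde, tilde, ← hlong]
  nth_rw 2 [← hv]
  group

/-! ### The length function `ℓ̃` -/

/-- The exchange condition for `(W̃, S̃)`. -/
theorem exists_list_tilde_mul {Sg : Set W} (hSg : GoodSubset cs Sg) {i : B}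
    (hi : cs.simple i ∈ complSet cs Sg) {l : List W} (hl : ∀ y ∈ l, y ∈ relS cs Sg) {x : W}
    (hx : x ∈ relW cs Sg) (hd : ¬ cs.IsLeftDescent x i) (hd' : cs.IsLeftDescent (x * l.prod) i) :
    ∃ l' : List W, (∀ y ∈ l', y ∈ relS cs Sg) ∧ l'.length + 1 = l.length ∧
      tilde cs Sg (cs.simple i) * (x * l.prod) = x * l'.prod := by
  induction l generalizing x with
  | nil => exact absurd (by simpa using hd') hd
  | cons r l ih =>
    have hl' : ∀ y ∈ l, y ∈ relS cs Sg := fun y hy => hl y (by simp [hy])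
    obtain ⟨s, hs, rfl⟩ := hl r (by simp)
    obtain ⟨j, rfl⟩ := hs.1.1
    by_cases h : cs.IsLeftDescent (x * tilde cs Sg (cs.simple j)) i
    · refine ⟨l, hl', by simp, ?_⟩
      rw [← mul_assoc, tilde_mul_eq_mul_tilde hSg hx hi hs hd h, List.prod_cons, mul_assoc,
        ← mul_assoc (tilde cs Sg (cs.simple j)), tilde_mul_self hSg hs, one_mul]
    · rw [List.prod_cons, ← mul_assoc] at hd'
      obtain ⟨l', h1, h2, h3⟩ := ih hl' (relW_mul hSg.1 hx (tilde_mem_relW hSg hs)) h hd'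
      refine ⟨tilde cs Sg (cs.simple j) :: l', ?_, by simp [h2], ?_⟩
      · intro y hy
        rcases List.mem_cons.mp hy with rfl | hy
        · exact ⟨_, hs, rfl⟩
        · exact h1 y hy
      · rw [List.prod_cons, List.prod_cons, ← mul_assoc x, h3, mul_assoc]

theorem exists_list_prod_eq {Sg : Set W} (hSg : GoodSubset cs Sg) {w : W}
    (hw : w ∈ relW cs Sg) : ∃ l : List W, (∀ y ∈ l, y ∈ relS cs Sg) ∧ l.prod = w := by
  induction hn : cs.length w using Nat.strong_induction_on generalizing w with
  | _ n ih =>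
    by_cases h1 : w = 1
    · exact ⟨[], by simp, by simp [h1]⟩
    obtain ⟨i, hd⟩ := cs.exists_leftDescent_of_ne_one h1
    obtain ⟨hi, hlen⟩ := isLeftDescent_relW hSg hw hd
    have hpos := length_tilde_pos hSg hi
    obtain ⟨l, hl, hlp⟩ := ih _ (by omega) (relW_mul hSg.1 (tilde_mem_relW hSg hi) hw) rfl
    refine ⟨tilde cs Sg (cs.simple i) :: l, ?_, ?_⟩
    · intro y hy
      rcases List.mem_cons.mp hy with rfl | hy
      · exact ⟨_, hi, rfl⟩
      · exact hl y hy
    · rw [List.prod_cons, hlp, ← mul_assoc, tilde_mul_self hSg hi, one_mul]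

theorem relLength_prod_le {Sg : Set W} {l : List W} (hl : ∀ y ∈ l, y ∈ relS cs Sg) :
    relLength cs Sg l.prod ≤ l.length :=
  sInf_le ⟨l, hl, rfl, rfl⟩

theorem exists_list_length_eq_relLength {Sg : Set W} (hSg : GoodSubset cs Sg) {w : W}
    (hw : w ∈ relW cs Sg) : ∃ l : List W, (∀ y ∈ l, y ∈ relS cs Sg) ∧ l.prod = w ∧
      (l.length : ℕ∞) = relLength cs Sg w := by
  obtain ⟨l, hl, hlp⟩ := exists_list_prod_eq hSg hw
  exact csInf_mem (s := {q : ℕ∞ | ∃ l : List W, (∀ x ∈ l, x ∈ relS cs Sg) ∧ l.prod = w ∧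
    (l.length : ℕ∞) = q}) ⟨_, l, hl, hlp, rfl⟩

theorem relLength_tilde_mul_of_isLeftDescent {Sg : Set W} (hSg : GoodSubset cs Sg) {w : W}
    (hw : w ∈ relW cs Sg) {i : B} (hi : cs.simple i ∈ complSet cs Sg)
    (hd : cs.IsLeftDescent w i) :
    relLength cs Sg (tilde cs Sg (cs.simple i) * w) + 1 = relLength cs Sg w := by
  have hw' := relW_mul hSg.1 (tilde_mem_relW hSg hi) hw
  obtain ⟨l, hl, hlp, hlen⟩ := exists_list_length_eq_relLength hSg hw
  obtain ⟨m, hm, hmp, hmlen⟩ := exists_list_length_eq_relLength hSg hw'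
  obtain ⟨l', hl', hlen', hlp'⟩ := exists_list_tilde_mul hSg hi hl (relW_one hSg.1)
    (by simp [CoxeterSystem.IsLeftDescent]) (by rwa [one_mul, hlp])
  rw [one_mul, one_mul, hlp] at hlp'
  have h1 := relLength_prod_le hl'
  rw [← hlp', ← hmlen] at h1
  have h2 : relLength cs Sg (tilde cs Sg (cs.simple i) :: m).prod ≤
      (tilde cs Sg (cs.simple i) :: m).length := by
    refine relLength_prod_le fun y hy => ?_
    rcases List.mem_cons.mp hy with rfl | hy
    · exact ⟨_, hi, rfl⟩
    · exact hm y hy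
  rw [List.prod_cons, hmp, ← mul_assoc, tilde_mul_self hSg hi, one_mul, ← hlen,
    List.length_cons] at h2
  rw [← hmlen, ← hlen]
  norm_cast at h1 h2 ⊢
  omega

theorem relLength_tilde_mul_of_not_isLeftDescent {Sg : Set W} (hSg : GoodSubset cs Sg) {w : W}
    (hw : w ∈ relW cs Sg) {i : B} (hi : cs.simple i ∈ complSet cs Sg)
    (hd : ¬ cs.IsLeftDescent w i) :
    relLength cs Sg (tilde cs Sg (cs.simple i) * w) = relLength cs Sg w + 1 := by
  have hw' := relW_mul hSg.1 (tilde_mem_relW hSg hi) hw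
  have hcancel : tilde cs Sg (cs.simple i) * (tilde cs Sg (cs.simple i) * w) = w := by
    rw [← mul_assoc, tilde_mul_self hSg hi, one_mul]
  have hd' : cs.IsLeftDescent (tilde cs Sg (cs.simple i) * w) i := by
    by_contra h
    have h1 := length_tilde_mul_of_not_isLeftDescent hSg hw' hi h
    rw [hcancel, length_tilde_mul_of_not_isLeftDescent hSg hw hi hd] at h1
    have := length_tilde_pos hSg hi
    omega
  rw [← relLength_tilde_mul_of_isLeftDescent hSg hw' hi hd', hcancel]

variable (cs)

/-- for `w ∈ W̃` and `s̃ ∈ S̃`: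
`ℓ̃(s̃w) = ℓ̃(w) + 1 ↔ ℓ(s̃w) = ℓ(w) + ℓ(s̃)` and
`ℓ̃(s̃w) = ℓ̃(w) − 1 ↔ ℓ(s̃w) = ℓ(w) − ℓ(s̃)`. -/
theorem relLength_mul_tilde_iff (Sg : Set W) (hSg : GoodSubset cs Sg)
    (w s : W) (hw : w ∈ relW cs Sg) (hs : s ∈ relS cs Sg) :
    (relLength cs Sg (s * w) = relLength cs Sg w + 1 ↔
      cs.length (s * w) = cs.length w + cs.length s) ∧
    (relLength cs Sg (s * w) + 1 = relLength cs Sg w ↔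
      cs.length (s * w) + cs.length s = cs.length w) := by
  obtain ⟨t, ht, rfl⟩ := hs
  obtain ⟨i, rfl⟩ := ht.1.1
  have hpos := length_tilde_pos hSg ht
  obtain ⟨l, -, -, hlen⟩ := exists_list_length_eq_relLength hSg hw
  obtain ⟨m, -, -, hmlen⟩ :=
    exists_list_length_eq_relLength hSg (relW_mul hSg.1 (tilde_mem_relW hSg ht) hw)
  by_cases hd : cs.IsLeftDescent w i
  · have h1 := (isLeftDescent_relW hSg hw hd).2
    have h2 := relLength_tilde_mul_of_isLeftDescent hSg hw ht hd
    rw [← hlen, ← hmlen] at h2 ⊢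
    norm_cast at h2 ⊢
    omega
  · have h1 := length_tilde_mul_of_not_isLeftDescent hSg hw ht hd
    have h2 := relLength_tilde_mul_of_not_isLeftDescent hSg hw ht hd
    rw [← hlen, ← hmlen] at h2 ⊢
    norm_cast at h2 ⊢
    omega

end RelativeCoxeter
end

section
/- Let Σ, Σ' ⊆ S be such that W_Σ and W_{Σ'} are finite, and let y ∈ N(Σ, Σ'). Then there exist a sequence Σ₁, …, Σ_q of subsets of S and a sequence y₁, …, y_{q−1} of elements of W such that: (1) Σ₁ = Σ and Σ_q = Σ'; (2) each W_{Σ_i} is finite; (3) for each i = 1, …, q−1 one has y_i ∈ N(Σ_i, Σ_{i+1}) and there exists s_i ∈ S ∖ Σ_i with W_{Σ_i ∪ {s_i}} finite and y_i = w₀^{Σ_i ∪ {s_i}} w₀^{Σ_i}; (4) y = y_{q−1} ⋯ y₂ y₁ and ℓ(y) = ℓ(y₁) + ⋯ + ℓ(y_{q−1}). -/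
/-!
Relative Coxeter groups: common definitions.

`(W, S)` is a Coxeter system (Mathlib's `CoxeterSystem M W`), `ℓ = cs.length`.
For `w : W`, `invSet cs w` is the set `T(w)` of left inversions of `w`, and
`descSet cs w = T(w) ∩ S` is `D(w)`.  For a subset `Sg ⊆ S` (playing the role of `Σ`),
`par Sg` is the standard parabolic subgroup `W_Σ`, `parRefl Sg` its set of
reflections `T_Σ`, `minRight cs Sg = W^Σ`, `minLeft cs Sg = ^ΣW`,
`relN cs Sg Sg' = N(Σ, Σ')`, `IsLongest cs Sg w` says `w` is a longest element of `W_Σ`,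
`longest cs Sg` is the longest element `w₀^Σ`, `relW cs Sg = W̃`,
`complSet cs Sg = Σ^∁`, `tilde cs Sg s = s̃ = w₀^{Σ∪{s}} w₀^Σ`, `relS cs Sg = S̃`,
`relLength cs Sg = ℓ̃ : W → ℕ∞`, and `GoodSubset cs Sg` records the standing
hypotheses (1) and (2) on `Σ`.
-/

namespace RelativeCoxeter

variable {B W : Type*} [Group W] {M : CoxeterMatrix B}

variable (cs : CoxeterSystem M W)

/-! ### The reflection cocycle and the strong exchange property -/

section Cocycle

open Classical in
/-- The action of a simple reflection on `W × ZMod 2` which conjugates the first coordinate and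
switches the second one exactly when the first coordinate is that simple reflection. -/
noncomputable def reflStep (i : B) : Function.End (W × ZMod 2) :=
  fun p => (cs.simple i * p.1 * cs.simple i, p.2 + if p.1 = cs.simple i then 1 else 0)

open Classical in
lemma reflStep_mul_pow_apply (i j : B) (m : ℕ) (p : W × ZMod 2) :
    ((reflStep cs i * reflStep cs j) ^ m) p =
      ((cs.simple i * cs.simple j) ^ m * p.1 * ((cs.simple i * cs.simple j) ^ m)⁻¹,
        p.2 + ∑ k ∈ Finset.range (2 * m),
          if p.1 = ((cs.simple i * cs.simple j) ^ k)⁻¹ * cs.simple j then 1 else 0) := by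
  set c := cs.simple i * cs.simple j with hc
  have hji : cs.simple j * c = c⁻¹ * cs.simple j := by simp [hc, mul_assoc]
  have hjc (m : ℕ) : cs.simple j * c ^ m = (c ^ m)⁻¹ * cs.simple j := by
    induction m with
    | zero => simp
    | succ m ih =>
      rw [pow_succ, ← mul_assoc, ih, mul_assoc, hji, ← mul_assoc, mul_inv_rev, ← mul_inv_rev,
        ← pow_succ, ← mul_inv_rev, ← pow_succ']
  induction m with
  | zero =>
    have h1 : (1 : Function.End (W × ZMod 2)) p = p := rfl
    simp [h1]
  | succ m ih =>
    have e1 : c ^ m * p.1 * (c ^ m)⁻¹ = cs.simple j ↔ p.1 = (c ^ (2 * m))⁻¹ * cs.simple j := by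
      rw [mul_inv_eq_iff_eq_mul, hjc, ← eq_inv_mul_iff_mul_eq, ← mul_assoc, ← mul_inv_rev,
        ← pow_add, two_mul]
    have e2 : cs.simple j * (c ^ m * p.1 * (c ^ m)⁻¹) * cs.simple j = cs.simple i ↔
        p.1 = (c ^ (2 * m + 1))⁻¹ * cs.simple j := by
      have : cs.simple j * (c ^ m * p.1 * (c ^ m)⁻¹) * cs.simple j = cs.simple i ↔
          c ^ m * p.1 * (c ^ m)⁻¹ = c⁻¹ * cs.simple j := by
        constructor
        · intro h
          have := congrArg (fun x => cs.simple j * x * cs.simple j) h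
          simpa [mul_assoc, hc] using this
        · intro h
          rw [h]
          simp [mul_assoc, hc]
      rw [this, mul_inv_eq_iff_eq_mul, mul_assoc, hjc, ← mul_assoc, ← mul_inv_rev, ← pow_succ,
        ← eq_inv_mul_iff_mul_eq, ← mul_assoc, ← mul_inv_rev, ← pow_add]
      ring_nf
    have hs : ((reflStep cs i * reflStep cs j) ^ (m + 1)) p =
        reflStep cs i (reflStep cs j (((reflStep cs i * reflStep cs j) ^ m) p)) := by
      rw [pow_succ']
      rfl
    rw [hs, ih]
    ext
    · simp [reflStep, pow_succ', hc, mul_assoc]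
    · rw [show 2 * (m + 1) = 2 * m + 1 + 1 by ring, Finset.sum_range_succ,
        Finset.sum_range_succ]
      simp only [reflStep, e1, e2, add_assoc]

lemma reflStep_isLiftable : M.IsLiftable (reflStep cs) := by
  classical
  intro i j
  funext p
  rw [reflStep_mul_pow_apply]
  have h : ∑ k ∈ Finset.range (2 * M i j),
      (if p.1 = ((cs.simple i * cs.simple j) ^ k)⁻¹ * cs.simple j then (1 : ZMod 2) else 0)
        = 0 := by
    rw [two_mul, Finset.sum_range_add]
    simp only [pow_add, cs.simple_mul_simple_pow, one_mul]
    exact CharTwo.add_self_eq_zero _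
  rw [h, cs.simple_mul_simple_pow]
  simp [Function.End.one_def]

/-- The reflection representation of `W` by transformations of `W × ZMod 2`. -/
noncomputable def reflRep : W →* Function.End (W × ZMod 2) :=
  cs.lift ⟨reflStep cs, reflStep_isLiftable cs⟩

/-- The parity of the number of occurrences of `t` in the right inversion sequence of any word
for `w`. -/
noncomputable def invParity (w t : W) : ZMod 2 := (reflRep cs w (t, 0)).2

lemma reflRep_apply (w : W) (p : W × ZMod 2) :
    reflRep cs w p = (w * p.1 * w⁻¹, p.2 + invParity cs w p.1) := by
  induction w using cs.simple_induction_left generalizing p with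
  | one => simp [invParity, Function.End.one_def]
  | mul_simple_left w i ih =>
    have h (q : W × ZMod 2) : reflRep cs (cs.simple i * w) q =
        reflStep cs i (reflRep cs w q) := by
      rw [map_mul, reflRep, cs.lift_apply_simple]
      rfl
    simp only [invParity, h]
    rw [ih p, ih (p.1, 0)]
    simp only [reflStep, mul_inv_rev, cs.inv_simple, mul_assoc, add_assoc, zero_add]

lemma invParity_mul (x y t : W) :
    invParity cs (x * y) t = invParity cs y t + invParity cs x (y * t * y⁻¹) := by
  have : reflRep cs (x * y) (t, 0) = reflRep cs x (reflRep cs y (t, 0)) := by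
    rw [map_mul]
    rfl
  rw [invParity, this, reflRep_apply cs y, reflRep_apply cs x]
  simp

@[simp] lemma invParity_one (t : W) : invParity cs 1 t = 0 := by
  simp [invParity, Function.End.one_def]

open Classical in
lemma invParity_simple (i : B) (t : W) :
    invParity cs (cs.simple i) t = if t = cs.simple i then 1 else 0 := by
  simp [invParity, reflRep, reflStep]

open Classical in
lemma invParity_wordProd (ω : List B) (t : W) :
    invParity cs (cs.wordProd ω) t = ((cs.rightInvSeq ω).count t : ZMod 2) := by
  induction ω with
  | nil => simp
  | cons i ω ih =>
    rw [cs.wordProd_cons, invParity_mul, ih, invParity_simple, CoxeterSystem.rightInvSeq,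
      List.count_cons]
    have : cs.wordProd ω * t * (cs.wordProd ω)⁻¹ = cs.simple i ↔
        (cs.wordProd ω)⁻¹ * cs.simple i * cs.wordProd ω = t := by
      rw [mul_inv_eq_iff_eq_mul, ← eq_inv_mul_iff_mul_eq, mul_assoc, eq_comm]
    simp [this]

lemma invParity_self {t : W} (ht : cs.IsReflection t) : invParity cs t t = 1 := by
  obtain ⟨u, i, rfl⟩ := ht
  have h : invParity cs u⁻¹ (u * cs.simple i * u⁻¹) + invParity cs u (cs.simple i) = 0 := by
    have := invParity_mul cs u u⁻¹ (u * cs.simple i * u⁻¹)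
    simpa [mul_assoc] using this.symm
  rw [invParity_mul, invParity_mul]
  simp only [inv_inv, mul_assoc, inv_mul_cancel, mul_one, one_mul, if_true,
    inv_mul_cancel_left, cs.simple_mul_simple_self, cs.inv_simple, invParity_simple] at h ⊢
  linear_combination h

lemma mem_rightInvSeq_of_invParity {ω : List B} {t : W}
    (h : invParity cs (cs.wordProd ω) t = 1) : t ∈ cs.rightInvSeq ω := by
  classical
  rw [invParity_wordProd] at h
  by_contra hn
  rw [List.count_eq_zero_of_not_mem hn] at h
  simp at h

lemma length_mul_lt_of_invParity {w t : W} (h : invParity cs w t = 1) :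
    cs.length (w * t) < cs.length w := by
  obtain ⟨ω, hω, rfl⟩ := cs.exists_isReduced w
  exact (cs.isRightInversion_of_mem_rightInvSeq hω (mem_rightInvSeq_of_invParity cs h)).2

lemma invParity_eq_one_iff {w t : W} (ht : cs.IsReflection t) :
    invParity cs w t = 1 ↔ cs.length (w * t) < cs.length w := by
  refine ⟨length_mul_lt_of_invParity cs, fun h => ?_⟩
  by_contra hn
  have h0 : invParity cs w t = 0 := by
    generalize invParity cs w t = a at hn
    revert a
    decide
  have h1 : invParity cs (w * t) t = 1 := by
    rw [invParity_mul, invParity_self cs ht]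
    simp [h0]
  have := length_mul_lt_of_invParity cs h1
  rw [mul_assoc, ht.mul_self, mul_one] at this
  exact this.not_gt h

lemma mem_invSet_iff {w t : W} :
    t ∈ invSet cs w ↔ cs.IsReflection t ∧ invParity cs w⁻¹ t = 1 := by
  refine and_congr_right fun ht => ?_
  rw [invParity_eq_one_iff cs ht, cs.length_inv, ← cs.length_inv (t * w), mul_inv_rev, ht.inv]

lemma mem_invSet_mul {x y t : W} (ht : cs.IsReflection t) :
    t ∈ invSet cs (x * y) ↔ ¬(t ∈ invSet cs x ↔ x⁻¹ * t * x ∈ invSet cs y) := by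
  have ht' : cs.IsReflection (x⁻¹ * t * x) := by simpa using ht.conj x⁻¹
  simp only [mem_invSet_iff, ht, ht', true_and, mul_inv_rev, invParity_mul, inv_inv]
  generalize invParity cs x⁻¹ t = a
  generalize invParity cs y⁻¹ (x⁻¹ * t * x) = b
  revert a b
  decide

end Cocycle

/-! ### Parabolic subgroups -/

section Parabolic

variable {cs} {J : Set W}

lemma mem_par_of_mem {r : W} (h : r ∈ J) : r ∈ par J := Subgroup.subset_closure h

lemma par_mono {J K : Set W} (h : J ⊆ K) : par J ≤ par K := Subgroup.closure_mono h

lemma isReflection_of_mem_simpleSet {r : W} (h : r ∈ simpleSet cs) : cs.IsReflection r := by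
  obtain ⟨i, rfl⟩ := h
  exact cs.isReflection_simple i

lemma mem_simpleSet_iff {r : W} : r ∈ simpleSet cs ↔ cs.length r = 1 := by
  simp only [simpleSet, Set.mem_range, cs.length_eq_one_iff, eq_comm]

lemma isReflection_of_mem_parRefl (hJ : J ⊆ simpleSet cs) {t : W} (ht : t ∈ parRefl J) :
    cs.IsReflection t := by
  obtain ⟨u, -, r, hr, rfl⟩ := ht
  exact (isReflection_of_mem_simpleSet (hJ hr)).conj u

lemma mem_par_of_mem_parRefl {t : W} (ht : t ∈ parRefl J) : t ∈ par J := by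
  obtain ⟨u, hu, r, hr, rfl⟩ := ht
  exact mul_mem (mul_mem hu (mem_par_of_mem hr)) (inv_mem hu)

lemma mem_parRefl_of_mem {r : W} (h : r ∈ J) : r ∈ parRefl J :=
  ⟨1, one_mem _, r, h, by simp⟩

lemma conj_mem_parRefl {a t : W} (ha : a ∈ par J) (ht : t ∈ parRefl J) :
    a⁻¹ * t * a ∈ parRefl J := by
  obtain ⟨u, hu, r, hr, rfl⟩ := ht
  exact ⟨a⁻¹ * u, mul_mem (inv_mem ha) hu, r, hr, by group⟩

lemma parRefl_mono {J K : Set W} (h : J ⊆ K) : parRefl J ⊆ parRefl K := by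
  rintro t ⟨u, hu, r, hr, rfl⟩
  exact ⟨u, par_mono h hu, r, h hr, rfl⟩

lemma length_simple_mul_eq {r w : W} (hr : r ∈ simpleSet cs) (h : r ∉ invSet cs w) :
    cs.length (r * w) = cs.length w + 1 := by
  have hrefl := isReflection_of_mem_simpleSet hr
  obtain ⟨i, rfl⟩ := hr
  rcases cs.length_simple_mul w i with h1 | h1
  · exact h1
  · exact absurd ⟨hrefl, by omega⟩ h

lemma exists_word_of_mem_par (hJ : J ⊆ simpleSet cs) {w : W} (hw : w ∈ par J) :
    ∃ ω : List B, (∀ i ∈ ω, cs.simple i ∈ J) ∧ cs.IsReduced ω ∧ w = cs.wordProd ω := by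
  have step (r : W) (hr : r ∈ J) (w : W) (h : ∃ ω : List B, (∀ i ∈ ω, cs.simple i ∈ J) ∧
      cs.IsReduced ω ∧ w = cs.wordProd ω) :
      ∃ ω : List B, (∀ i ∈ ω, cs.simple i ∈ J) ∧ cs.IsReduced ω ∧ r * w = cs.wordProd ω := by
    obtain ⟨ω, hωJ, hω, rfl⟩ := h
    by_cases h : r ∈ invSet cs (cs.wordProd ω)
    · have h1 := (mem_invSet_iff cs).1 h
      rw [← cs.wordProd_reverse] at h1
      have h2 := mem_rightInvSeq_of_invParity cs h1.2
      rw [cs.rightInvSeq_reverse, List.mem_reverse] at h2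
      obtain ⟨j, hj, hjr⟩ := List.mem_iff_getElem.mp h2
      have h3 := cs.getD_leftInvSeq_mul_wordProd ω j
      rw [List.getD_eq_getElem _ 1 hj, hjr] at h3
      rw [cs.length_leftInvSeq] at hj
      refine ⟨ω.eraseIdx j, fun i hi => hωJ i (List.mem_of_mem_eraseIdx hi), ?_, h3⟩
      have h4 := cs.length_wordProd_le (ω.eraseIdx j)
      have h5 := List.length_eraseIdx_add_one hj
      obtain ⟨i, rfl⟩ := hJ hr
      have h6 := cs.length_simple_mul (cs.wordProd ω) i
      rw [h3, hω.eq] at h6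
      have h7 : cs.length (cs.wordProd (ω.eraseIdx j)) = (ω.eraseIdx j).length := by omega
      exact h7
    · have h1 := length_simple_mul_eq (hJ hr) h
      obtain ⟨i, rfl⟩ := hJ hr
      refine ⟨i :: ω, ?_, ?_, (cs.wordProd_cons i ω).symm⟩
      · simpa using ⟨hr, hωJ⟩
      · have h2 : cs.length (cs.wordProd (i :: ω)) = (i :: ω).length := by
          rw [cs.wordProd_cons, h1, hω.eq, List.length_cons]
        exact h2
  induction hw using Subgroup.closure_induction_left with
  | one => exact ⟨[], by simp, by simp [CoxeterSystem.IsReduced], by simp⟩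
  | mul_left r hr w _ ih => exact step r hr w ih
  | inv_mul_cancel r hr w _ ih =>
    rw [(isReflection_of_mem_simpleSet (hJ hr)).inv]
    exact step r hr w ih

/-- Induction on an element of a parabolic subgroup along a reduced decomposition. -/
lemma par_induction (hJ : J ⊆ simpleSet cs) {p : W → Prop} (one : p 1)
    (step : ∀ r ∈ J, ∀ w ∈ par J, r ∉ invSet cs w →
      cs.length (r * w) = cs.length w + 1 → p w → p (r * w))
    {w : W} (hw : w ∈ par J) : p w := by
  obtain ⟨ω, hωJ, hω, rfl⟩ := exists_word_of_mem_par hJ hw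
  clear hw
  induction ω with
  | nil => simpa using one
  | cons i ω ih =>
    have hω' : cs.IsReduced ω := by simpa using hω.drop 1
    have hi : cs.simple i ∈ J := hωJ i (by simp)
    have hωJ' : ∀ j ∈ ω, cs.simple j ∈ J := fun j hj => hωJ j (by simp [hj])
    have hl : cs.length (cs.simple i * cs.wordProd ω) = cs.length (cs.wordProd ω) + 1 := by
      rw [← cs.wordProd_cons, hω.eq, hω'.eq, List.length_cons]
    rw [cs.wordProd_cons]
    refine step _ hi _ ?_ (fun h => ?_) hl (ih hωJ' hω')
    · exact Subgroup.list_prod_mem _ fun x hx => by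
        obtain ⟨j, hj, rfl⟩ := List.mem_map.1 hx
        exact mem_par_of_mem (hωJ' j hj)
    · have := h.2
      omega

lemma mem_of_mem_par_of_mem_simpleSet (hJ : J ⊆ simpleSet cs) {r : W} (hr : r ∈ par J)
    (hs : r ∈ simpleSet cs) : r ∈ J := by
  rw [mem_simpleSet_iff] at hs
  revert hs
  refine par_induction hJ (p := fun r => cs.length r = 1 → r ∈ J) (by simp) ?_ hr
  intro r hr w _ _ hl _ h1
  have : cs.length w = 0 := by omega
  rw [cs.length_eq_zero_iff] at this
  simpa [this] using hr

lemma par_injective {J K : Set W} (hJ : J ⊆ simpleSet cs) (hK : K ⊆ simpleSet cs)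
    (h : par J = par K) : J = K :=
  Set.Subset.antisymm
    (fun _ hr => mem_of_mem_par_of_mem_simpleSet hK (h ▸ mem_par_of_mem hr) (hJ hr))
    (fun _ hr => mem_of_mem_par_of_mem_simpleSet hJ (h ▸ mem_par_of_mem hr) (hK hr))

lemma eq_of_mem_invSet_simple {r t : W} (hr : r ∈ simpleSet cs) (h : t ∈ invSet cs r) :
    t = r := by
  have h1 := h.2
  rw [mem_simpleSet_iff.1 hr, Nat.lt_one_iff, cs.length_eq_zero_iff] at h1
  rw [← (isReflection_of_mem_simpleSet hr).inv]
  exact eq_inv_of_mul_eq_one_left h1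

lemma invSet_subset_parRefl (hJ : J ⊆ simpleSet cs) {w : W} (hw : w ∈ par J) :
    invSet cs w ⊆ parRefl J := by
  refine par_induction hJ (p := fun w => invSet cs w ⊆ parRefl J) ?_ ?_ hw
  · intro t ht
    simp [invSet] at ht
  · intro r hr w _ _ _ ih t ht
    by_cases h : t ∈ invSet cs r
    · exact eq_of_mem_invSet_simple (hJ hr) h ▸ mem_parRefl_of_mem hr
    · rw [mem_invSet_mul cs ht.1] at ht
      have h1 : r⁻¹ * t * r ∈ invSet cs w := by tauto
      have := conj_mem_parRefl (inv_mem (mem_par_of_mem hr)) (ih h1)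
      simpa [mul_assoc] using this

lemma mem_parRefl_of_mem_par (hJ : J ⊆ simpleSet cs) {t : W} (ht : cs.IsReflection t)
    (h : t ∈ par J) : t ∈ parRefl J := by
  refine invSet_subset_parRefl hJ h ⟨ht, ?_⟩
  rw [ht.mul_self, cs.length_one]
  exact ht.odd_length.pos

lemma mem_minLeft_iff {w : W} : w ∈ minLeft cs J ↔ ∀ t ∈ parRefl J, t ∉ invSet cs w := by
  simp only [minLeft, Set.mem_ofPred_eq, ← Set.disjoint_iff_inter_eq_empty,
    Set.disjoint_right]

lemma mem_minRight_iff {w : W} : w ∈ minRight cs J ↔ w⁻¹ ∈ minLeft cs J := Iff.rfl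

lemma length_mul_of_mem_minLeft (hJ : J ⊆ simpleSet cs) {a w : W} (hw : w ∈ minLeft cs J)
    (ha : a ∈ par J) : cs.length (a * w) = cs.length a + cs.length w := by
  refine par_induction hJ (p := fun a => cs.length (a * w) = cs.length a + cs.length w)
    (by simp) ?_ ha
  intro r hr a ha hra hl ih
  have hn : r ∉ invSet cs (a * w) := by
    rw [mem_invSet_mul cs (isReflection_of_mem_simpleSet (hJ hr))]
    have := mem_minLeft_iff.1 hw _ (conj_mem_parRefl ha (mem_parRefl_of_mem hr))
    tauto
  rw [mul_assoc, length_simple_mul_eq (hJ hr) hn, ih, hl]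
  omega

lemma length_mul_of_mem_minRight (hJ : J ⊆ simpleSet cs) {a w : W} (hw : w ∈ minRight cs J)
    (ha : a ∈ par J) : cs.length (w * a) = cs.length w + cs.length a := by
  have := length_mul_of_mem_minLeft hJ hw (inv_mem ha)
  rw [← mul_inv_rev, cs.length_inv, cs.length_inv, cs.length_inv] at this
  omega

lemma exists_par_mul_minLeft (J : Set W) (w : W) :
    ∃ a ∈ par J, ∃ b ∈ minLeft cs J, w = a * b := by
  obtain ⟨a, ha⟩ := exists_minimalFor_of_wellFoundedLT (fun a => a ∈ par J)
    (fun a => cs.length (a * w)) ⟨1, one_mem _⟩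
  refine ⟨a⁻¹, inv_mem ha.1, a * w, mem_minLeft_iff.2 fun t ht h => ?_, by simp⟩
  have h1 := ha.2 (j := t * a) (mul_mem (mem_par_of_mem_parRefl ht) ha.1)
  simp only [mul_assoc] at h1
  exact absurd h.2 (not_lt.2 (h1 h.2.le))

/-! ### Longest elements -/

lemma length_add_of_forall_descent (hJ : J ⊆ simpleSet cs) {u x : W} (hu : J ⊆ invSet cs u)
    (hx : x ∈ par J) : cs.length x + cs.length (x⁻¹ * u) = cs.length u := by
  refine par_induction hJ (p := fun x => cs.length x + cs.length (x⁻¹ * u) = cs.length u)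
    (by simp) ?_ hx
  intro r hr x hx hrx hl ih
  have hrr := isReflection_of_mem_simpleSet (hJ hr)
  have h1 : r ∈ invSet cs (x * (x⁻¹ * u)) := by simpa using hu hr
  rw [mem_invSet_mul cs hrr] at h1
  have h2 : x⁻¹ * r * x ∈ invSet cs (x⁻¹ * u) := by tauto
  have h3 := h2.2
  have h4 : x⁻¹ * r * x * (x⁻¹ * u) = (r * x)⁻¹ * u := by
    rw [mul_inv_rev, hrr.inv]
    group
  rw [h4] at h3
  have h5 := cs.length_mul_le (r * x) ((r * x)⁻¹ * u)
  rw [mul_inv_cancel_left] at h5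
  omega

lemma parRefl_subset_invSet (hJ : J ⊆ simpleSet cs) {u : W} (hu : J ⊆ invSet cs u) :
    parRefl J ⊆ invSet cs u := by
  intro t ht
  have hr := isReflection_of_mem_parRefl hJ ht
  refine ⟨hr, ?_⟩
  have h := length_add_of_forall_descent hJ hu (mem_par_of_mem_parRefl ht)
  rw [hr.inv] at h
  have := hr.odd_length.pos
  omega

lemma invSet_finite (w : W) : (invSet cs w).Finite := by
  obtain ⟨ω, -, rfl⟩ := cs.exists_isReduced w
  refine (List.finite_toSet (cs.rightInvSeq ω.reverse)).subset fun t ht => ?_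
  have h := ((mem_invSet_iff cs).1 ht).2
  rw [← cs.wordProd_reverse] at h
  exact mem_rightInvSeq_of_invParity cs h

lemma eq_of_invSet_eq {x y : W} (h : invSet cs x = invSet cs y) : x = y := by
  by_contra hne
  have h1 : x⁻¹ * y ≠ 1 := fun h => hne (inv_mul_eq_one.1 h)
  obtain ⟨i, hi⟩ := cs.exists_leftDescent_of_ne_one h1
  have hr := cs.isReflection_simple i
  have h2 : cs.simple i ∈ invSet cs (x⁻¹ * y) := ⟨hr, hi⟩
  have h3 : cs.simple i ∉ invSet cs (x⁻¹ * x) := by simp [invSet]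
  rw [mem_invSet_mul cs hr] at h2 h3
  rw [h] at h3
  exact h3 h2

lemma par_finite_of_forall_descent (hJ : J ⊆ simpleSet cs) {u : W} (hu : J ⊆ invSet cs u) :
    (par J : Set W).Finite := by
  refine Set.Finite.of_finite_image (f := invSet cs) ?_ fun x _ y _ h => eq_of_invSet_eq h
  refine (invSet_finite (cs := cs) u).finite_subsets.subset ?_
  rintro _ ⟨x, hx, rfl⟩
  exact (invSet_subset_parRefl hJ hx).trans (parRefl_subset_invSet hJ hu)

lemma longest_isLongest (hfin : (par J : Set W).Finite) : IsLongest cs J (longest cs J) := by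
  have h : ∃ w, IsLongest cs J w := by
    obtain ⟨w, hw, hmax⟩ := hfin.exists_maximalFor cs.length _ ⟨1, one_mem (par J)⟩
    exact ⟨w, hw, fun u hu => (le_total _ _).elim id (hmax hu)⟩
  rw [longest, dif_pos h]
  exact h.choose_spec

lemma IsLongest.subset_invSet (hJ : J ⊆ simpleSet cs) {w : W} (hw : IsLongest cs J w) :
    J ⊆ invSet cs w := fun r hr => by
  by_contra h
  have h1 := length_simple_mul_eq (hJ hr) h
  have h2 := hw.2 (r * w) (mul_mem (mem_par_of_mem hr) hw.1)
  omega

lemma eq_longest (hJ : J ⊆ simpleSet cs) {u : W} (huJ : u ∈ par J) (hu : J ⊆ invSet cs u) :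
    u = longest cs J := by
  have hl := longest_isLongest (cs := cs) (par_finite_of_forall_descent hJ hu)
  have h1 := length_add_of_forall_descent hJ hu hl.1
  have h2 := hl.2 u huJ
  have h3 : cs.length ((longest cs J)⁻¹ * u) = 0 := by omega
  rw [cs.length_eq_zero_iff, inv_mul_eq_one] at h3
  exact h3.symm

lemma longest_inv (hJ : J ⊆ simpleSet cs) (hfin : (par J : Set W).Finite) :
    (longest cs J)⁻¹ = longest cs J := by
  have hl := longest_isLongest (cs := cs) hfin
  refine eq_longest hJ (inv_mem hl.1) (IsLongest.subset_invSet hJ ⟨inv_mem hl.1, fun u hu => ?_⟩)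
  rw [cs.length_inv]
  exact hl.2 u hu

lemma longest_mul_self (hJ : J ⊆ simpleSet cs) (hfin : (par J : Set W).Finite) :
    longest cs J * longest cs J = 1 := by
  nth_rw 1 [← longest_inv hJ hfin, inv_mul_cancel]

lemma longest_conj_mem (hJ : J ⊆ simpleSet cs) (hfin : (par J : Set W).Finite) {r : W}
    (hr : r ∈ J) : longest cs J * r * longest cs J ∈ J := by
  have hl := longest_isLongest (cs := cs) hfin
  have hd := hl.subset_invSet hJ
  have hrr := isReflection_of_mem_simpleSet (hJ hr)
  refine mem_of_mem_par_of_mem_simpleSet hJ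
    (mul_mem (mul_mem hl.1 (mem_par_of_mem hr)) hl.1) (mem_simpleSet_iff.2 ?_)
  have h1 := length_add_of_forall_descent hJ hd (mem_par_of_mem hr)
  have h2 := length_add_of_forall_descent hJ hd (mul_mem (mem_par_of_mem hr) hl.1)
  rw [hrr.inv] at h1
  rw [mul_inv_rev, longest_inv hJ hfin, hrr.inv] at h2
  rw [mem_simpleSet_iff.1 (hJ hr)] at h1
  omega

end Parabolic

/-! ### Splitting off an elementary factor -/

section Factor

variable {cs} {J : Set W}

lemma coe_par_conj (v : W) (J : Set W) :
    (par ((fun u => v * u * v⁻¹) '' J) : Set W) = (fun u => v * u * v⁻¹) '' (par J : Set W) :=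
  (congrArg SetLike.coe
    (MonoidHom.map_closure (MulAut.conj v).toMonoidHom J)).symm

lemma mem_invSet_inv_iff {v t : W} (ht : cs.IsReflection t) :
    t ∈ invSet cs v⁻¹ ↔ v * t * v⁻¹ ∈ invSet cs v := by
  have h : t ∉ invSet cs (v⁻¹ * v) := by simp [invSet]
  rw [mem_invSet_mul cs ht, inv_inv, not_not] at h
  exact h

lemma mem_relN_of_conj_subset {K K' : Set W} (hK : K ⊆ simpleSet cs) (hK' : K' ⊆ simpleSet cs)
    {y : W} (hy : y ∈ minRight cs K)
    (h : (fun u => y * u * y⁻¹) '' (par K : Set W) = (par K' : Set W)) : y ∈ relN cs K K' := by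
  refine ⟨hy, mem_minLeft_iff.2 fun t ht htinv => ?_, h⟩
  have hr := isReflection_of_mem_parRefl hK' ht
  obtain ⟨u, hu, rfl⟩ : t ∈ (fun u => y * u * y⁻¹) '' (par K : Set W) := by
    rw [h]
    exact mem_par_of_mem_parRefl ht
  have hur : cs.IsReflection u := (cs.isReflection_conj_iff y u).1 hr
  exact mem_minLeft_iff.1 (mem_minRight_iff.1 hy) u (mem_parRefl_of_mem_par hK hur hu)
    ((mem_invSet_inv_iff hur).2 htinv)

/-- If `s` is a right descent of `y ∈ N(K, K')`, then `y` factors, with additive lengths, through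
the elementary element attached to `K` and `s`. -/
lemma exists_elementary_factor {K K' : Set W} (hK : K ⊆ simpleSet cs) (hK' : K' ⊆ simpleSet cs)
    (hfin : (par K : Set W).Finite) {y : W} (hy : y ∈ relN cs K K') {s : W}
    (hs : s ∈ simpleSet cs) (hys : cs.length (y * s) < cs.length y) :
    s ∉ K ∧ (par (K ∪ {s}) : Set W).Finite ∧ ∃ L ⊆ simpleSet cs, ∃ y' ∈ relN cs L K',
      (par L : Set W).Finite ∧
      longest cs (K ∪ {s}) * longest cs K ∈ relN cs K L ∧
      y = y' * (longest cs (K ∪ {s}) * longest cs K) ∧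
      cs.length y = cs.length y' + cs.length (longest cs (K ∪ {s}) * longest cs K) ∧
      cs.length y' < cs.length y := by
  obtain ⟨hyR, hyL, hconj⟩ := hy
  have hsr := isReflection_of_mem_simpleSet hs
  have hsy : s ∈ invSet cs y⁻¹ := by
    refine ⟨hsr, ?_⟩
    rw [← cs.length_inv, mul_inv_rev, inv_inv, hsr.inv, cs.length_inv y]
    exact hys
  have hyR' := mem_minLeft_iff.1 (mem_minRight_iff.1 hyR)
  have hsK : s ∉ K := fun h => hyR' s (mem_parRefl_of_mem h) hsy
  have hlong := longest_isLongest (cs := cs) hfin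
  set w := longest cs K with hw
  have hwinv : w⁻¹ = w := longest_inv hK hfin
  have hw' : y * w * y⁻¹ ∈ par K' := by
    have : y * w * y⁻¹ ∈ (par K' : Set W) := hconj ▸ ⟨w, hlong.1, rfl⟩
    exact this
  have hz1 : cs.length (y * w) = cs.length y + cs.length w :=
    length_mul_of_mem_minRight hK hyR hlong.1
  have hz2 : cs.length (y * w) = cs.length (y * w * y⁻¹) + cs.length y := by
    have := length_mul_of_mem_minLeft hK' hyL hw'
    rwa [inv_mul_cancel_right] at this
  set J := K ∪ {s} with hJdef
  have hJ : J ⊆ simpleSet cs := Set.union_subset hK (Set.singleton_subset_iff.2 hs)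
  have hKJ : K ⊆ J := Set.subset_union_left
  have hsJ : s ∈ J := Or.inr rfl
  have hdesc : J ⊆ invSet cs (y * w)⁻¹ := by
    intro r hr
    have hrr := isReflection_of_mem_simpleSet (hJ hr)
    refine ⟨hrr, ?_⟩
    rw [← cs.length_inv, mul_inv_rev, inv_inv, hrr.inv, cs.length_inv (y * w)]
    rcases hr with hr | rfl
    · have h1 := (hlong.subset_invSet hK hr).2
      rw [← cs.length_inv, mul_inv_rev, hrr.inv, hwinv] at h1
      have h2 := cs.length_mul_le y (w * r)
      rw [← mul_assoc] at h2
      omega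
    · have h2 := cs.length_mul_le (y * w * y⁻¹) (y * r)
      rw [← mul_assoc, inv_mul_cancel_right] at h2
      omega
  obtain ⟨a, ha, b, hb, hab⟩ := exists_par_mul_minLeft (cs := cs) J (y * w)⁻¹
  have hbJ := mem_minLeft_iff.1 hb
  have hadesc : J ⊆ invSet cs a := by
    intro r hr
    have h1 := hdesc hr
    rw [hab, mem_invSet_mul cs (isReflection_of_mem_simpleSet (hJ hr))] at h1
    have := hbJ _ (conj_mem_parRefl ha (mem_parRefl_of_mem hr))
    tauto
  have hJfin := par_finite_of_forall_descent hJ hadesc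
  have haw : a = longest cs J := eq_longest hJ ha hadesc
  have hainv : a⁻¹ = a := by rw [haw, longest_inv hJ hJfin]
  have hawJ : a * w ∈ par J := mul_mem ha (par_mono hKJ hlong.1)
  have hyfac : y = b⁻¹ * (a * w) := by
    have : y * w = b⁻¹ * a⁻¹ := by rw [← mul_inv_rev, ← hab, inv_inv]
    rw [← mul_assoc, ← hainv, ← this, mul_assoc, longest_mul_self hK hfin, mul_one]
  have hbR : b⁻¹ ∈ minRight cs J := by rwa [mem_minRight_iff, inv_inv]
  have hylen : cs.length y = cs.length b⁻¹ + cs.length (a * w) := by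
    rw [← length_mul_of_mem_minRight hJ hbR hawJ, ← hyfac]
  have hvR : a * w ∈ minRight cs K := by
    rw [mem_minRight_iff, mem_minLeft_iff]
    intro t ht htv
    refine hyR' t ht ?_
    have htr := isReflection_of_mem_parRefl hK ht
    rw [hyfac, mul_inv_rev, inv_inv, mem_invSet_mul cs htr]
    have := hbJ _ (conj_mem_parRefl (inv_mem hawJ) (parRefl_mono hKJ ht))
    tauto
  set L := (fun u => a * w * u * (a * w)⁻¹) '' K with hL
  have hLJ : L ⊆ J := by
    rintro _ ⟨r, hr, rfl⟩
    have h1 := longest_conj_mem hJ hJfin (hKJ (longest_conj_mem hK hfin hr))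
    rw [← haw] at h1
    simpa [mul_assoc, hainv, hwinv] using h1
  have hLS := hLJ.trans hJ
  have hLpar : (par L : Set W) = (fun u => a * w * u * (a * w)⁻¹) '' (par K : Set W) :=
    coe_par_conj _ _
  rw [← haw]
  refine ⟨hsK, hJfin, L, hLS, b⁻¹, ?_, ?_, ?_, hyfac, hylen, ?_⟩
  · refine mem_relN_of_conj_subset hLS hK' ?_ ?_
    · rw [mem_minRight_iff, inv_inv, mem_minLeft_iff]
      exact fun t ht => hbJ t (parRefl_mono hLJ ht)
    · rw [hLpar, Set.image_image, ← hconj, hyfac]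
      refine Set.image_congr fun u _ => ?_
      group
  · rw [hLpar]
    exact hfin.image _
  · exact mem_relN_of_conj_subset hK hLS hvR hLpar.symm
  · have hne : cs.length (a * w) ≠ 0 := fun h0 => by
      rw [cs.length_eq_zero_iff] at h0
      rw [h0, mul_one] at hyfac
      rw [hyfac, inv_inv] at hsy
      exact hbJ s (mem_parRefl_of_mem hsJ) hsy
    omega

end Factor

/-- every `y ∈ N(Σ, Σ')` (with `W_Σ, W_{Σ'}` finite) factors as
`y = y_{q−1} ⋯ y₁` through a chain `Σ = Σ₁, …, Σ_q = Σ'` of finite-type subsets,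
with `y_i = w₀^{Σ_i∪{s_i}} w₀^{Σ_i} ∈ N(Σ_i, Σ_{i+1})` and additive lengths. -/
theorem relN_factorisation (Sg Sg' : Set W) (hSg : Sg ⊆ simpleSet cs)
    (hSg' : Sg' ⊆ simpleSet cs) (hfin : ((par Sg : Set W)).Finite)
    (hfin' : ((par Sg' : Set W)).Finite) (y : W) (hy : y ∈ relN cs Sg Sg') :
    ∃ (q : ℕ) (Sgs : Fin (q + 1) → Set W) (ys : Fin q → W),
      Sgs 0 = Sg ∧ Sgs (Fin.last q) = Sg' ∧
      (∀ i, ((par (Sgs i) : Set W)).Finite) ∧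
      (∀ i : Fin q, ys i ∈ relN cs (Sgs i.castSucc) (Sgs i.succ) ∧
        ∃ s ∈ simpleSet cs \ Sgs i.castSucc,
          ((par (Sgs i.castSucc ∪ {s}) : Set W)).Finite ∧
          ys i = longest cs (Sgs i.castSucc ∪ {s}) * longest cs (Sgs i.castSucc)) ∧
      y = (List.ofFn ys).reverse.prod ∧
      cs.length y = ∑ i, cs.length (ys i) := by
  induction hn : cs.length y using Nat.strong_induction_on generalizing Sg y with
  | _ n ih =>
  subst hn
  by_cases h1 : y = 1
  · subst h1
    have hpar : par Sg = par Sg' := SetLike.coe_injective (by simpa using hy.2.2)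
    exact ⟨0, fun _ => Sg, Fin.elim0, rfl, par_injective hSg hSg' hpar, fun _ => hfin,
      fun i => i.elim0, by simp, by simp⟩
  · obtain ⟨i, hi⟩ := cs.exists_rightDescent_of_ne_one h1
    obtain ⟨hsK, hJfin, L, hLS, y', hy', hLfin, hv, hfac, hlen, hlt⟩ :=
      exists_elementary_factor hSg hSg' hfin hy ⟨i, rfl⟩ hi
    obtain ⟨q, Sgs, ys, h0, hlast, hfins, hstep, hprod, hsum⟩ :=
      ih _ hlt L hLS hLfin y' hy' rfl
    refine ⟨q + 1, Fin.cons Sg Sgs,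
      Fin.cons (longest cs (Sg ∪ {cs.simple i}) * longest cs Sg) ys, rfl, ?_, ?_, ?_, ?_, ?_⟩
    · rw [← Fin.succ_last, Fin.cons_succ, hlast]
    · exact Fin.cases hfin hfins
    · refine Fin.cases ?_ fun j => ?_
      · simp only [Fin.castSucc_zero, Fin.cons_zero, Fin.cons_succ, h0]
        exact ⟨hv, cs.simple i, ⟨⟨i, rfl⟩, hsK⟩, hJfin, rfl⟩
      · simpa only [Fin.cons_succ, Fin.castSucc_succ] using hstep j
    · rw [List.ofFn_cons, List.reverse_cons, List.prod_append, ← hprod, List.prod_singleton]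
      exact hfac
    · rw [Fin.sum_univ_succ]
      simp only [Fin.cons_zero, Fin.cons_succ]
      omega

end RelativeCoxeter
end
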